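/- arXiv:2403.10189 — 2 statements merged into one kernel-verified Lean document; each statement's English description precedes it below -/
import Mathlib

section
/- For every nonnegative integer n, the number of partitions of n into parts each at least 3, with no two parts equal or consecutive, and with no two even parts equal or consecutive, equals the number of partitions of n into parts congruent to 3, 4, or 5 modulo 8. -/
/-- Odd parts are pairwise distinct. -/
def distinctOddParts (m : Multiset ℕ) : Prop := ∀ a, Odd a → m.count a ≤ 1

/-- Every even part is at least `k` (vacuous if no even part). -/
def minEvenGe (m : Multiset ℕ) (k : ℕ) : Prop := ∀ a ∈ m, Even a → k ≤ a

/-- Every odd part is at least `k` (vacuous if no odd part). -/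
def minOddGe (m : Multiset ℕ) (k : ℕ) : Prop := ∀ a ∈ m, Odd a → k ≤ a

/-- No two parts are equal or consecutive, and no two even parts are equal or
consecutive even numbers: parts pairwise differ by at least 2, even parts by at least 4. -/
def gapCond (m : Multiset ℕ) : Prop :=
  (∀ a, m.count a ≤ 1) ∧ (∀ a ∈ m, ∀ b ∈ m, a < b → a + 2 ≤ b) ∧
  (∀ a ∈ m, ∀ b ∈ m, Even a → Even b → a < b → a + 4 ≤ b)

/-- Number of even parts. -/
def evenCount (m : Multiset ℕ) : ℕ := (m.filter (fun a => Even a)).card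

/-- Number of odd parts. -/
def oddCount (m : Multiset ℕ) : ℕ := (m.filter (fun a => Odd a)).card

namespace GoellnitzGordon

open Finset PowerSeries

section CountingSeries

/-- The generating series of the partitions whose multiset of parts satisfies `P`. -/
noncomputable def partSeries (P : Multiset ℕ → Prop) : ℤ⟦X⟧ :=
  PowerSeries.mk fun n => ({p : n.Partition | P p.parts}.ncard : ℤ)

theorem partSeries_congr {P Q : Multiset ℕ → Prop} (h : ∀ m, P m ↔ Q m) :
    partSeries P = partSeries Q := by
  ext n
  simp only [partSeries, coeff_mk]
  congr 2
  ext p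
  exact h _

theorem ncard_cons_part (P : Multiset ℕ → Prop) {a : ℕ} (ha : 0 < a) (k : ℕ) :
    {p : (k + a).Partition | a ∈ p.parts ∧ P p.parts}.ncard =
      {p : k.Partition | P (a ::ₘ p.parts)}.ncard := by
  symm
  refine Set.ncard_congr (fun p _ => ⟨a ::ₘ p.parts, ?_, ?_⟩) ?_ ?_ ?_
  · intro i hi
    rcases Multiset.mem_cons.1 hi with rfl | hi
    · exact ha
    · exact p.parts_pos hi
  · rw [Multiset.sum_cons, p.parts_sum, add_comm]
  · intro p hp
    exact ⟨Multiset.mem_cons_self _ _, hp⟩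
  · intro p r _ _ h
    have h' := congrArg Nat.Partition.parts h
    exact Nat.Partition.ext ((Multiset.cons_inj_right a).1 h')
  · rintro p ⟨hap, hp⟩
    have hc : a ::ₘ p.parts.erase a = p.parts := Multiset.cons_erase hap
    refine ⟨⟨p.parts.erase a, fun hi => p.parts_pos (Multiset.mem_of_mem_erase hi), ?_⟩, ?_, ?_⟩
    · have h := congrArg Multiset.sum hc
      rw [Multiset.sum_cons, p.parts_sum] at h
      omega
    · simpa [hc] using hp
    · exact Nat.Partition.ext hc

theorem partSeries_split (P : Multiset ℕ → Prop) {a : ℕ} (ha : 0 < a) :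
    partSeries P =
      partSeries (fun m => a ∉ m ∧ P m) + X ^ a * partSeries (fun m => P (a ::ₘ m)) := by
  ext n
  simp only [partSeries, map_add, coeff_mk, coeff_X_pow_mul']
  have hsplit : {p : n.Partition | P p.parts}.ncard =
      {p : n.Partition | a ∉ p.parts ∧ P p.parts}.ncard +
        {p : n.Partition | a ∈ p.parts ∧ P p.parts}.ncard := by
    rw [← Set.ncard_union_eq]
    · congr 1
      ext p
      simp only [Set.mem_ofPred_eq, Set.mem_union]
      grind
    · rw [Set.disjoint_left]
      rintro p ⟨h, -⟩ ⟨h', -⟩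
      exact h h'
  rw [hsplit, Nat.cast_add]
  congr 1
  split_ifs with h
  · obtain ⟨k, rfl⟩ := Nat.exists_eq_add_of_le' h
    rw [ncard_cons_part P ha, Nat.add_sub_cancel]
  · have : {p : n.Partition | a ∈ p.parts ∧ P p.parts} = ∅ := by
      ext p
      simp only [Set.mem_ofPred_eq, Set.mem_empty_iff_false, iff_false, not_and]
      intro hp
      exact absurd (Nat.Partition.le_of_mem_parts hp) h
    simp [this]

theorem X_pow_dvd_partSeries_sub {P Q : Multiset ℕ → Prop} {M : ℕ}
    (h : ∀ n < M, ∀ p : n.Partition, P p.parts ↔ Q p.parts) :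
    X ^ M ∣ partSeries P - partSeries Q := by
  rw [X_pow_dvd_iff]
  intro n hn
  have : {p : n.Partition | P p.parts} = {p : n.Partition | Q p.parts} := by
    ext p
    exact h n hn p
  simp [partSeries, this]

theorem partSeries_eq_zero : partSeries (fun m => m = 0) = 1 := by
  ext n
  simp only [partSeries, coeff_mk, coeff_one]
  split_ifs with h
  · subst h
    have : {p : (0 : ℕ).Partition | p.parts = 0} = Set.univ := by
      ext p
      simp
    rw [this, Set.ncard_univ, Nat.card_unique, Nat.cast_one]
  · have : {p : n.Partition | p.parts = 0} = ∅ := by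
      ext p
      simp only [Set.mem_ofPred_eq, Set.mem_empty_iff_false, iff_false]
      intro hp
      apply h
      rw [← p.parts_sum, hp, Multiset.sum_zero]
    simp [this]

theorem partSeries_mem_mul_prod (S : Finset ℕ) (hS : 0 ∉ S) :
    partSeries (fun m => ∀ a ∈ m, a ∈ S) * ∏ a ∈ S, (1 - X ^ a) = 1 := by
  induction S using Finset.induction_on with
  | empty =>
    simpa [Multiset.eq_zero_iff_forall_notMem] using partSeries_eq_zero
  | insert a S ha ih =>
    simp only [Finset.mem_insert, not_or] at hS
    have h := partSeries_split (fun m => ∀ b ∈ m, b ∈ insert a S)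
      (Nat.pos_of_ne_zero (Ne.symm hS.1))
    have h₁ : partSeries (fun m => a ∉ m ∧ ∀ b ∈ m, b ∈ insert a S) =
        partSeries (fun m => ∀ b ∈ m, b ∈ S) := by
      apply partSeries_congr
      intro m
      grind
    have h₂ : partSeries (fun m => ∀ b ∈ a ::ₘ m, b ∈ insert a S) =
        partSeries (fun m => ∀ b ∈ m, b ∈ insert a S) := by
      apply partSeries_congr
      intro m
      simp
    rw [h₁, h₂] at h
    rw [Finset.prod_insert ha]
    linear_combination ih hS.2 + (∏ b ∈ S, (1 - X ^ b)) * h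

/-- The multisets satisfying the gap conditions with all parts at least `2 * i + 1`. -/
def GapFrom (i : ℕ) (m : Multiset ℕ) : Prop := (∀ a ∈ m, 2 * i + 1 ≤ a) ∧ gapCond m

theorem gapCond_cons {a : ℕ} {m : Multiset ℕ} (h : ∀ b ∈ m, a < b) :
    gapCond (a ::ₘ m) ↔
      gapCond m ∧ (∀ b ∈ m, a + 2 ≤ b) ∧ (Even a → ∀ b ∈ m, Even b → a + 4 ≤ b) := by
  have ha : a ∉ m := fun ha => lt_irrefl _ (h a ha)
  have h₀ : (∀ b, (a ::ₘ m).count b ≤ 1) ↔ ∀ b, m.count b ≤ 1 := by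
    simp only [← Multiset.nodup_iff_count_le_one, Multiset.nodup_cons, ha, not_false_eq_true,
      true_and]
  simp only [gapCond, h₀, Multiset.mem_cons]
  grind

theorem partSeries_gapFrom (i : ℕ) :
    partSeries (GapFrom i) = (1 + X ^ (2 * i + 1)) * partSeries (GapFrom (i + 1)) +
      X ^ (2 * i + 2) * partSeries (GapFrom (i + 2)) := by
  have h₁ := partSeries_split (GapFrom i) (a := 2 * i + 1) (Nat.succ_pos _)
  have h₂ := partSeries_split (fun m => 2 * i + 1 ∉ m ∧ GapFrom i m) 
    (a := 2 * i + 2) (Nat.succ_pos _)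
  have e₁ : partSeries (fun m => GapFrom i ((2 * i + 1) ::ₘ m)) = partSeries (GapFrom (i + 1)) := by
    apply partSeries_congr
    intro m
    constructor
    · rintro ⟨hm, hg⟩
      have hlt : ∀ b ∈ m, 2 * i + 1 < b := by
        intro b hb
        refine lt_of_le_of_ne (hm b (Multiset.mem_cons_of_mem hb)) ?_
        rintro rfl
        exact (Multiset.nodup_cons.1 (Multiset.nodup_iff_count_le_one.2 hg.1)).1 hb
      rw [gapCond_cons hlt] at hg
      exact ⟨fun b hb => by have := hg.2.1 b hb; omega, hg.1⟩
    · rintro ⟨hm, hg⟩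
      have hlt : ∀ b ∈ m, 2 * i + 1 < b := fun b hb => by have := hm b hb; omega
      refine ⟨fun b hb => ?_, (gapCond_cons hlt).2 ⟨hg, fun b hb => ?_, fun he => ?_⟩⟩
      · rcases Multiset.mem_cons.1 hb with rfl | hb
        · exact le_rfl
        · exact (hlt b hb).le
      · have := hm b hb; omega
      · exact absurd he (by simp)
  have e₂ : partSeries (fun m => 2 * i + 2 ∉ m ∧ 2 * i + 1 ∉ m ∧ GapFrom i m) =
      partSeries (GapFrom (i + 1)) := by
    apply partSeries_congr
    intro m
    constructor
    · rintro ⟨h2, h1, hm, hg⟩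
      refine ⟨fun b hb => ?_, hg⟩
      have := hm b hb
      have : b ≠ 2 * i + 1 := fun h => h1 (h ▸ hb)
      have : b ≠ 2 * i + 2 := fun h => h2 (h ▸ hb)
      omega
    · rintro ⟨hm, hg⟩
      refine ⟨fun h => ?_, fun h => ?_, fun b hb => ?_, hg⟩
      · have := hm _ h; omega
      · have := hm _ h; omega
      · have := hm b hb; omega
  have e₃ : partSeries (fun m => 2 * i + 1 ∉ (2 * i + 2) ::ₘ m ∧ GapFrom i ((2 * i + 2) ::ₘ m)) =
      partSeries (GapFrom (i + 2)) := by
    apply partSeries_congr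
    intro m
    constructor
    · rintro ⟨h1, hm, hg⟩
      have hlt : ∀ b ∈ m, 2 * i + 2 < b := by
        intro b hb
        have hb₁ := hm b (Multiset.mem_cons_of_mem hb)
        have hb₂ : b ≠ 2 * i + 1 := fun h => h1 (h ▸ Multiset.mem_cons_of_mem hb)
        have hb₃ : b ≠ 2 * i + 2 := by
          rintro rfl
          exact (Multiset.nodup_cons.1 (Multiset.nodup_iff_count_le_one.2 hg.1)).1 hb
        omega
      rw [gapCond_cons hlt] at hg
      refine ⟨fun b hb => ?_, hg.1⟩
      have hb₁ := hg.2.1 b hb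
      have hb₂ := hg.2.2 ⟨i + 1, by ring⟩ b hb
      by_contra hcon
      have hb₃ : b = 2 * i + 4 := by omega
      have := hb₂ ⟨i + 2, by omega⟩
      omega
    · rintro ⟨hm, hg⟩
      have hlt : ∀ b ∈ m, 2 * i + 2 < b := fun b hb => by have := hm b hb; omega
      refine ⟨fun h => ?_, fun b hb => ?_,
        (gapCond_cons hlt).2 ⟨hg, fun b hb => ?_, fun he b hb hb' => ?_⟩⟩
      · rcases Multiset.mem_cons.1 h with h | h
        · omega
        · have := hm _ h; omega
      · rcases Multiset.mem_cons.1 hb with rfl | hb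
        · omega
        · have := hlt b hb; omega
      · have := hm b hb; omega
      · obtain ⟨c, rfl⟩ := hb'
        have := hm _ hb
        omega
  rw [e₁] at h₁
  rw [e₂, e₃] at h₂
  linear_combination h₁ + h₂

theorem X_pow_dvd_partSeries_gapFrom_sub_one {i M : ℕ} (h : M ≤ i) :
    X ^ M ∣ partSeries (GapFrom i) - 1 := by
  rw [← partSeries_eq_zero]
  apply X_pow_dvd_partSeries_sub
  intro n hn p
  constructor
  · rintro ⟨hp, -⟩
    rw [Multiset.eq_zero_iff_forall_notMem]
    intro a ha
    have h₁ := hp a ha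
    have h₂ := Nat.Partition.le_of_mem_parts ha
    omega
  · intro hp
    simp [GapFrom, gapCond, hp]

end CountingSeries

section AlternatingSum

variable {R : Type*} [CommRing R]

/-- The product `(q^(2*n+2); q^2)_m`. -/
def evenProd (q : R) (n m : ℕ) : R := ∏ j ∈ range m, (1 - q ^ (2 * (n + j) + 2))

/-- The product `(-q; q^2)_n`. -/
def oddProd (q : R) (n : ℕ) : R := ∏ j ∈ range n, (1 + q ^ (2 * j + 1))

/-- The product of the factors `1 + q^(2*j+1)` for `k ≤ j < M`. -/
def oddTail (q : R) (M k : ℕ) : R := ∏ j ∈ Ico k M, (1 + q ^ (2 * j + 1))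

theorem evenProd_succ (q : R) (n m : ℕ) :
    evenProd q n (m + 1) = evenProd q n m * (1 - q ^ (2 * (n + m) + 2)) :=
  prod_range_succ _ _

theorem mul_evenProd_succ_left (q : R) (n m : ℕ) :
    (1 - q ^ (2 * n + 2)) * evenProd q (n + 1) m = evenProd q n (m + 1) := by
  rw [evenProd, evenProd, prod_range_succ', mul_comm]
  simp only [add_zero]
  congr 1
  refine prod_congr rfl fun j _ => ?_
  rw [add_assoc n 1 j, add_comm 1 j]

theorem oddProd_succ (q : R) (n : ℕ) : oddProd q (n + 1) = oddProd q n * (1 + q ^ (2 * n + 1)) :=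
  prod_range_succ _ _

theorem oddTail_eq {q : R} {M : ℕ} (hq : q ^ M = 0) (k : ℕ) :
    oddTail q M k = (1 + q ^ (2 * k + 1)) * oddTail q M (k + 1) := by
  rcases lt_or_ge k M with h | h
  · rw [oddTail, oddTail, prod_eq_prod_Ico_succ_bot h]
  · rw [oddTail, oddTail, Ico_eq_empty_of_le h, Ico_eq_empty_of_le (h.trans k.le_succ),
      pow_eq_zero_of_le (show M ≤ 2 * k + 1 by omega) hq]
    simp

theorem oddProd_mul_oddTail {q : R} {M : ℕ} (hq : q ^ M = 0) (n : ℕ) :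
    oddProd q n * oddTail q M n = oddProd q M := by
  induction n with
  | zero => simp [oddProd, oddTail]
  | succ n ih => rw [← ih, oddTail_eq hq n, oddProd_succ, mul_assoc]

/-- The summand of the first alternating series. -/
def termA (q : R) (M m n : ℕ) : R :=
  (-1) ^ n * q ^ (4 * n ^ 2 + 3 * n + 4 * m * n) * (1 - q ^ (2 * m + 2 + 4 * n)) *
    evenProd q n m * oddProd q n * oddTail q M (n + m + 1)

/-- The summand of the second alternating series. -/
def termB (q : R) (M m n : ℕ) : R :=
  (-1) ^ n * q ^ (4 * n ^ 2 + n + 4 * m * n) * (1 - q ^ (4 * m + 4 + 8 * n)) *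
    evenProd q n m * oddProd q n * oddTail q M (n + m + 1)

theorem sum_termB {q : R} {M : ℕ} (hq : q ^ M = 0) (m : ℕ) :
    ∑ n ∈ range M, termB q M m n =
      ∑ n ∈ range M, termA q M m n + q ^ (2 * m + 2) * ∑ n ∈ range M, termA q M (m + 1) n := by
  set r : ℕ → R := fun n => (-1) ^ n * q ^ (4 * n ^ 2 + n + 4 * m * n) * (1 - q ^ (2 * n)) *
    evenProd q n m * oddProd q n * oddTail q M (n + m + 1) with hr
  have h : ∀ n, termB q M m n - termA q M m n - q ^ (2 * m + 2) * termA q M (m + 1) n =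
      r n - r (n + 1) := by
    intro n
    have h₁ := evenProd_succ q n m
    have h₂ := (mul_evenProd_succ_left q n m).trans h₁
    have h₃ := oddProd_succ q n
    have h₄ := oddTail_eq hq (n + m + 1)
    simp only [hr, termA, termB, h₁, h₃, h₄]
    rw [show n + (m + 1) + 1 = n + m + 1 + 1 by ring, show n + 1 + m + 1 = n + m + 1 + 1 by ring]
    generalize oddTail q M (n + m + 1 + 1) = w
    generalize oddProd q n = v
    linear_combination (-(-1) ^ n * q ^ (4 * (n + 1) ^ 2 + (n + 1) + 4 * m * (n + 1)) *
      (1 + q ^ (2 * n + 1)) * v * w) * h₂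
  have hs : ∑ n ∈ range M, (r n - r (n + 1)) = 0 := by
    rw [sum_range_sub', hr]
    simp only
    rw [pow_eq_zero_of_le (by nlinarith : M ≤ 4 * M ^ 2 + M + 4 * m * M) hq]
    simp
  rw [mul_sum, ← sub_eq_zero, ← sub_sub, ← sum_sub_distrib, ← sum_sub_distrib, ← hs]
  exact sum_congr rfl fun n _ => h n

theorem sum_termA {q : R} {M : ℕ} (hq : q ^ M = 0) (m : ℕ) :
    ∑ n ∈ range M, termA q M m n = ∑ n ∈ range M, termB q M (m + 1) n +
      q ^ (2 * m + 3) * ∑ n ∈ range M, termA q M (m + 1) n := by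
  set r : ℕ → R := fun n => (-1) ^ n * q ^ (4 * n ^ 2 + 3 * n + 4 * m * n) * (1 - q ^ (2 * n)) *
    evenProd q n m * oddProd q n * oddTail q M (n + m + 1) with hr
  have h : ∀ n, termA q M m n - termB q M (m + 1) n - q ^ (2 * m + 3) * termA q M (m + 1) n =
      r n - r (n + 1) := by
    intro n
    have h₁ := evenProd_succ q n m
    have h₂ := (mul_evenProd_succ_left q n m).trans h₁
    have h₃ := oddProd_succ q n
    have h₄ := oddTail_eq hq (n + m + 1)
    simp only [hr, termA, termB, h₁, h₃, h₄]
    rw [show n + (m + 1) + 1 = n + m + 1 + 1 by ring, show n + 1 + m + 1 = n + m + 1 + 1 by ring]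
    generalize oddTail q M (n + m + 1 + 1) = w
    generalize oddProd q n = v
    linear_combination (-(-1) ^ n * q ^ (4 * (n + 1) ^ 2 + 3 * (n + 1) + 4 * m * (n + 1)) *
      (1 + q ^ (2 * n + 1)) * v * w) * h₂
  have hs : ∑ n ∈ range M, (r n - r (n + 1)) = 0 := by
    rw [sum_range_sub', hr]
    simp only
    rw [pow_eq_zero_of_le (by nlinarith : M ≤ 4 * M ^ 2 + 3 * M + 4 * m * M) hq]
    simp
  rw [mul_sum, ← sub_eq_zero, ← sub_sub, ← sum_sub_distrib, ← sum_sub_distrib, ← hs]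
  exact sum_congr rfl fun n _ => h n

theorem sum_termA_recurrence {q : R} {M : ℕ} (hq : q ^ M = 0) (m : ℕ) :
    ∑ n ∈ range M, termA q M m n =
      (1 + q ^ (2 * m + 3)) * ∑ n ∈ range M, termA q M (m + 1) n +
        q ^ (2 * m + 4) * ∑ n ∈ range M, termA q M (m + 2) n := by
  linear_combination sum_termA hq m + sum_termB hq (m + 1)

/-- Factors `1 - q^(a*j+b)` with `j ≥ M` are trivial when `q^M = 0`. -/
theorem prod_range_eq_of_pow_eq_zero {q : R} {M K a b : ℕ} (hq : q ^ M = 0) (hK : M ≤ K)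
    (ha : 0 < a) :
    ∏ j ∈ range K, (1 - q ^ (a * j + b)) = ∏ j ∈ range M, (1 - q ^ (a * j + b)) := by
  symm
  apply prod_subset (range_mono hK)
  intro j _ hj
  rw [pow_eq_zero_of_le _ hq, sub_zero]
  have h₁ : M ≤ j := by simpa using hj
  nlinarith

theorem sum_termA_of_le {q : R} {M m : ℕ} (hq : q ^ M = 0) (hM : 0 < M) (hm : M ≤ m) :
    ∑ n ∈ range M, termA q M m n = ∏ j ∈ range M, (1 - q ^ (2 * j + 2)) := by
  rw [sum_eq_single 0]
  · rw [← prod_range_eq_of_pow_eq_zero hq hm two_pos]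
    simp only [termA, oddTail, Ico_eq_empty_of_le (show M ≤ 0 + m + 1 by omega),
      pow_eq_zero_of_le (show M ≤ 2 * m + 2 + 4 * 0 by omega) hq]
    simp [evenProd, oddProd]
  · intro n _ hn
    have : 0 < n := Nat.pos_of_ne_zero hn
    rw [termA, pow_eq_zero_of_le (by nlinarith : M ≤ 4 * n ^ 2 + 3 * n + 4 * m * n) hq]
    simp
  · simp [hM.ne']

theorem sum_termA_zero {q : R} {M : ℕ} (hq : q ^ M = 0) :
    ∑ n ∈ range M, termA q M 0 n = oddProd q M *
      ∑ n ∈ range M, (-1) ^ n * q ^ (4 * n ^ 2 + 3 * n) * (1 - q ^ (2 * n + 1)) := by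
  rw [mul_sum]
  refine sum_congr rfl fun n _ => ?_
  have h := oddProd_mul_oddTail hq n
  rw [oddTail_eq hq] at h
  rw [← h, termA]
  simp only [evenProd, range_zero, prod_empty, add_zero]
  ring

/-- A solution of the recurrence that is eventually `1` is proportional to the alternating sum. -/
theorem mul_prod_eq_of_recurrence {q : R} {M : ℕ} (hq : q ^ M = 0) (hM : 0 < M) (a : ℕ → R)
    (ha : ∀ i, a i = (1 + q ^ (2 * i + 1)) * a (i + 1) + q ^ (2 * i + 2) * a (i + 2))
    (ha' : ∀ i, M ≤ i → a i = 1) (m : ℕ) :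
    a (m + 1) * ∏ j ∈ range M, (1 - q ^ (2 * j + 2)) = ∑ n ∈ range M, termA q M m n := by
  have key : ∀ k m, M ≤ m + k →
      a (m + 1) * ∏ j ∈ range M, (1 - q ^ (2 * j + 2)) = ∑ n ∈ range M, termA q M m n := by
    intro k
    induction k using Nat.strong_induction_on with
    | _ k ih =>
      intro m hk
      rcases Nat.eq_zero_or_pos k with rfl | hk₀
      · rw [ha' _ (by omega), one_mul, sum_termA_of_le hq hM (by omega)]
      · have h₁ := ih (k - 1) (by omega) (m + 1) (by omega)
        have h₂ := ih (k - 1) (by omega) (m + 2) (by omega)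
        rw [sum_termA_recurrence hq, ← h₁, ← h₂, ha (m + 1)]
        ring
  exact key M m (by omega)

end AlternatingSum

section TripleProduct

variable {A : Type*} [CommRing A]

/-- The Gaussian binomial coefficients in base `Q`. -/
def gaussBinom (Q : A) : ℕ → ℕ → A
  | _, 0 => 1
  | 0, _ + 1 => 0
  | n + 1, k + 1 => gaussBinom Q n k + Q ^ (k + 1) * gaussBinom Q n (k + 1)

theorem gaussBinom_zero_right (Q : A) (n : ℕ) : gaussBinom Q n 0 = 1 := by
  cases n <;> rfl

theorem gaussBinom_eq_zero (Q : A) : ∀ {n k : ℕ}, n < k → gaussBinom Q n k = 0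
  | _, 0, h => absurd h (Nat.not_lt_zero _)
  | 0, _ + 1, _ => rfl
  | n + 1, k + 1, h => by
    rw [gaussBinom, gaussBinom_eq_zero Q (by omega), gaussBinom_eq_zero Q (by omega)]
    simp

theorem gaussBinom_self (Q : A) (n : ℕ) : gaussBinom Q n n = 1 := by
  induction n with
  | zero => rfl
  | succ n ih => rw [gaussBinom, ih, gaussBinom_eq_zero Q (Nat.lt_succ_self n)]; simp

/-- The product `(Q; Q)_n`. -/
def qFactorial (Q : A) (n : ℕ) : A := ∏ j ∈ range n, (1 - Q ^ (j + 1))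

theorem qFactorial_succ (Q : A) (n : ℕ) :
    qFactorial Q (n + 1) = qFactorial Q n * (1 - Q ^ (n + 1)) :=
  prod_range_succ _ _

theorem qFactorial_mul_gaussBinom (Q : A) (n : ℕ) : ∀ k l, k + l = n →
    qFactorial Q k * qFactorial Q l * gaussBinom Q n k = qFactorial Q n := by
  induction n with
  | zero =>
    intro k l h
    obtain ⟨rfl, rfl⟩ : k = 0 ∧ l = 0 := by omega
    simp [qFactorial, gaussBinom]
  | succ n ih =>
    rintro (_ | k) (_ | l) h
    · omega
    · obtain rfl : l = n := by omega
      simp [gaussBinom_zero_right, qFactorial]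
    · obtain rfl : k = n := by omega
      simp [gaussBinom_self, qFactorial]
    · have h₁ := ih k (l + 1) (by omega)
      have h₂ := ih (k + 1) l (by omega)
      obtain rfl : n = k + l + 1 := by omega
      rw [gaussBinom, qFactorial_succ Q (k + l + 1)]
      rw [qFactorial_succ] at h₁ h₂ ⊢
      rw [qFactorial_succ Q l]
      linear_combination (1 - Q ^ (k + 1)) * h₁ + Q ^ (k + 1) * (1 - Q ^ (l + 1)) * h₂

/-- The homogeneous `q`-binomial theorem in base `t^2`. -/
theorem prod_add_mul_pow (t y : A) (n : ℕ) : ∀ z : A,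
    ∏ j ∈ range n, (y + z * (t ^ 2) ^ j) = ∑ k ∈ range (n + 1),
      t ^ (k * (k - 1)) * gaussBinom (t ^ 2) n k * z ^ k * y ^ (n - k) := by
  induction n with
  | zero => simp [gaussBinom]
  | succ n ih =>
    intro z
    have h : ∏ j ∈ range n, (y + z * (t ^ 2) ^ (j + 1)) =
        ∏ j ∈ range n, (y + z * t ^ 2 * (t ^ 2) ^ j) :=
      prod_congr rfl fun j _ => by ring
    rw [prod_range_succ', h, ih (z * t ^ 2), sum_range_succ' _ (n + 1)]
    have hsplit : ∀ k ∈ range (n + 1),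
        t ^ ((k + 1) * (k + 1 - 1)) * gaussBinom (t ^ 2) (n + 1) (k + 1) * z ^ (k + 1) *
          y ^ (n + 1 - (k + 1)) =
        z * (t ^ (k * (k - 1)) * gaussBinom (t ^ 2) n k * (z * t ^ 2) ^ k * y ^ (n - k)) +
        t ^ ((k + 1) * (k + 1 - 1)) * gaussBinom (t ^ 2) n (k + 1) * (z * t ^ 2) ^ (k + 1) *
          y ^ (n - k) := by
      intro k _
      have hk : t ^ ((k + 1) * (k + 1 - 1)) = t ^ (k * (k - 1)) * (t ^ 2) ^ k := by
        rw [← pow_mul, ← pow_add]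
        congr 1
        cases k with
        | zero => rfl
        | succ k => simp only [Nat.add_sub_cancel]; ring
      rw [gaussBinom, hk, Nat.add_sub_add_right n 1 k]
      ring
    rw [sum_congr rfl hsplit, sum_add_distrib, ← mul_sum]
    have hy : ∑ k ∈ range (n + 1), t ^ ((k + 1) * (k + 1 - 1)) * gaussBinom (t ^ 2) n (k + 1) *
          (z * t ^ 2) ^ (k + 1) * y ^ (n - k) + y ^ (n + 1) =
        y * ∑ k ∈ range (n + 1),
          t ^ (k * (k - 1)) * gaussBinom (t ^ 2) n k * (z * t ^ 2) ^ k * y ^ (n - k) := by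
      rw [sum_range_succ, gaussBinom_eq_zero _ (Nat.lt_succ_self n), sum_range_succ' _ n, mul_add,
        mul_sum]
      have : ∀ k ∈ range n, t ^ ((k + 1) * (k + 1 - 1)) * gaussBinom (t ^ 2) n (k + 1) *
            (z * t ^ 2) ^ (k + 1) * y ^ (n - k) =
          y * (t ^ ((k + 1) * (k + 1 - 1)) * gaussBinom (t ^ 2) n (k + 1) *
            (z * t ^ 2) ^ (k + 1) * y ^ (n - (k + 1))) := by
        intro k hk
        have hk' : k < n := mem_range.1 hk
        rw [show n - k = n - (k + 1) + 1 by omega, pow_succ]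
        ring
      rw [sum_congr rfl this]
      simp only [gaussBinom_zero_right, Nat.sub_zero]
      ring
    simp only [gaussBinom_zero_right, Nat.sub_zero, pow_zero, zero_mul, mul_one, one_mul]
    linear_combination -hy

theorem map_gaussBinom {B : Type*} [CommRing B] (f : A →+* B) (Q : A) :
    ∀ n k, f (gaussBinom Q n k) = gaussBinom (f Q) n k
  | _, 0 => by simp [gaussBinom_zero_right]
  | 0, _ + 1 => by simp [gaussBinom]
  | n + 1, k + 1 => by
    simp [gaussBinom, map_gaussBinom f Q n k, map_gaussBinom f Q n (k + 1)]

theorem prod_range_pow_eight (q : A) (L : ℕ) :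
    ∏ j ∈ range (L + 1), q ^ (8 * j) = q ^ (4 * (L * (L + 1))) := by
  induction L with
  | zero => simp
  | succ L ih => rw [prod_range_succ, ih]; ring

theorem prod_shifted_eq (q : A) (L : ℕ) :
    ∏ j ∈ range (L + 1 + (L + 1)), (q ^ (8 * L + 7) + -1 * ((q ^ 4) ^ 2) ^ j) =
      ((-1) ^ (L + 1) * q ^ (4 * (L * (L + 1)) + (8 * L + 7) * (L + 1))) *
        ((∏ j ∈ range (L + 1), (1 - q ^ (8 * j + 1))) *
          ∏ j ∈ range (L + 1), (1 - q ^ (8 * j + 7))) := by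
  have h₁ : ∏ j ∈ range (L + 1), (q ^ (8 * L + 7) + -1 * ((q ^ 4) ^ 2) ^ j) =
      (-1) ^ (L + 1) * q ^ (4 * (L * (L + 1))) * ∏ j ∈ range (L + 1), (1 - q ^ (8 * j + 7)) := by
    rw [← prod_range_pow_eight, ← prod_range_reflect (fun j => 1 - q ^ (8 * j + 7))]
    nth_rewrite 2 [← card_range (L + 1)]
    rw [← prod_const, ← prod_mul_distrib, ← prod_mul_distrib]
    refine prod_congr rfl fun j hj => ?_
    obtain ⟨d, rfl⟩ := Nat.exists_eq_add_of_le (Nat.lt_succ_iff.1 (mem_range.1 hj))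
    rw [show j + d + 1 - 1 - j = d by omega]
    ring
  have h₂ : ∏ j ∈ range (L + 1), (q ^ (8 * L + 7) + -1 * ((q ^ 4) ^ 2) ^ (L + 1 + j)) =
      q ^ ((8 * L + 7) * (L + 1)) * ∏ j ∈ range (L + 1), (1 - q ^ (8 * j + 1)) := by
    have hc : q ^ ((8 * L + 7) * (L + 1)) = ∏ _j ∈ range (L + 1), q ^ (8 * L + 7) := by
      rw [prod_const, card_range, pow_mul]
    rw [hc, ← prod_mul_distrib]
    refine prod_congr rfl fun j _ => ?_
    ring
  rw [prod_range_add, h₁, h₂]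
  ring

theorem sum_shifted_eq (q : A) (g : ℕ → A) (L : ℕ) :
    ∑ k ∈ range (L + 1 + (L + 1) + 1), (q ^ 4) ^ (k * (k - 1)) * g k * (-1) ^ k *
        (q ^ (8 * L + 7)) ^ (L + 1 + (L + 1) - k) =
      ((-1) ^ (L + 1) * q ^ (4 * (L * (L + 1)) + (8 * L + 7) * (L + 1))) *
        (∑ n ∈ range (L + 1 + 1), (-1) ^ n * q ^ (4 * n ^ 2 + 3 * n) * g (L + 1 - n) -
          ∑ n ∈ range (L + 1), (-1) ^ n * q ^ (4 * n ^ 2 + 5 * n + 1) * g (L + 1 + 1 + n)) := by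
  have hsign : ∀ n : ℕ, (-1 : A) ^ n * (-1) ^ n = 1 := fun n => by rw [← mul_pow]; simp
  rw [show L + 1 + (L + 1) + 1 = (L + 1 + 1) + (L + 1) by ring, sum_range_add, mul_sub,
    sub_eq_add_neg, mul_sum, mul_sum, ← sum_neg_distrib,
    ← sum_range_reflect _ (L + 1 + 1)]
  congr 1
  · refine sum_congr rfl fun n hn => ?_
    obtain ⟨d, hd⟩ := Nat.exists_eq_add_of_le (Nat.lt_succ_iff.1 (mem_range.1 hn))
    rw [show L + 1 + 1 - 1 - n = d by omega, show L + 1 - n = d by omega,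
      show L + 1 + (L + 1) - d = L + 1 + n by omega]
    have hs : (-1 : A) ^ d = (-1) ^ (L + 1) * (-1) ^ n := by
      rw [hd, pow_add]
      linear_combination -(-1) ^ d * hsign n
    have he : 4 * (d * (d - 1)) + (8 * L + 7) * (L + 1 + n) =
        4 * (L * (L + 1)) + (8 * L + 7) * (L + 1) + (4 * n ^ 2 + 3 * n) := by
      rcases d with _ | d
      · obtain rfl : n = L + 1 := by omega
        ring
      · obtain rfl : L = n + d := by omega
        rw [Nat.add_sub_cancel]
        ring
    have hp : (q ^ 4) ^ (d * (d - 1)) * (q ^ (8 * L + 7)) ^ (L + 1 + n) =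
        q ^ (4 * (L * (L + 1)) + (8 * L + 7) * (L + 1)) * q ^ (4 * n ^ 2 + 3 * n) := by
      rw [← pow_mul, ← pow_mul, ← pow_add, ← pow_add, he]
    rw [hs]
    linear_combination (g d * (-1) ^ (L + 1) * (-1) ^ n) * hp
  · refine sum_congr rfl fun n hn => ?_
    obtain ⟨d, rfl⟩ := Nat.exists_eq_add_of_le (Nat.lt_succ_iff.1 (mem_range.1 hn))
    rw [show n + d + 1 + (n + d + 1) - (n + d + 1 + 1 + n) = d by omega,
      show n + d + 1 + 1 + n - 1 = n + d + 1 + n by omega]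
    ring

/-- A finite form of the Jacobi triple product identity. -/
theorem finite_triple_product (q : A) (N : ℕ) :
    (∏ j ∈ range N, (1 - q ^ (8 * j + 1))) * ∏ j ∈ range N, (1 - q ^ (8 * j + 7)) =
      ∑ n ∈ range (N + 1),
          (-1) ^ n * q ^ (4 * n ^ 2 + 3 * n) * gaussBinom (q ^ 8) (N + N) (N - n) -
        ∑ n ∈ range N,
          (-1) ^ n * q ^ (4 * n ^ 2 + 5 * n + 1) * gaussBinom (q ^ 8) (N + N) (N + 1 + n) := by
  rcases N with _ | L
  · simp [gaussBinom]
  have h : (∏ j ∈ range (L + 1), (1 - (Polynomial.X : Polynomial ℤ) ^ (8 * j + 1))) *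
        ∏ j ∈ range (L + 1), (1 - Polynomial.X ^ (8 * j + 7)) =
      ∑ n ∈ range (L + 1 + 1), (-1) ^ n * Polynomial.X ^ (4 * n ^ 2 + 3 * n) *
          gaussBinom (Polynomial.X ^ 8) (L + 1 + (L + 1)) (L + 1 - n) -
        ∑ n ∈ range (L + 1), (-1) ^ n * Polynomial.X ^ (4 * n ^ 2 + 5 * n + 1) *
          gaussBinom (Polynomial.X ^ 8) (L + 1 + (L + 1)) (L + 1 + 1 + n) := by
    have hp := prod_add_mul_pow ((Polynomial.X : Polynomial ℤ) ^ 4) (Polynomial.X ^ (8 * L + 7))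
      (L + 1 + (L + 1)) (-1)
    rw [prod_shifted_eq, sum_shifted_eq, ← pow_mul] at hp
    exact mul_left_cancel₀
      (mul_ne_zero (pow_ne_zero _ (by simp)) (pow_ne_zero _ Polynomial.X_ne_zero)) hp
  have hX : Polynomial.eval₂RingHom (Int.castRingHom A) q Polynomial.X = q := by simp
  simpa only [map_mul, map_prod, map_sub, map_sum, map_pow, map_one, map_neg, map_gaussBinom, hX]
    using congrArg (Polynomial.eval₂RingHom (Int.castRingHom A) q) h

theorem isUnit_one_sub_pow {q : A} {M : ℕ} (hq : q ^ M = 0) {k : ℕ} (hk : 0 < k) :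
    IsUnit (1 - q ^ k) :=
  IsNilpotent.isUnit_one_sub ⟨M, by rw [← pow_mul, mul_comm, pow_mul, hq, zero_pow hk.ne']⟩

theorem isUnit_prod_one_sub_pow {q : A} {M : ℕ} (hq : q ^ M = 0) (s : Finset ℕ) (f : ℕ → ℕ)
    (hf : ∀ j, 0 < f j) : IsUnit (∏ j ∈ s, (1 - q ^ f j)) :=
  (IsUnit.prod_iff).2 fun j _ => isUnit_one_sub_pow hq (hf j)

theorem qFactorial_pow_eight (q : A) (n : ℕ) :
    qFactorial (q ^ 8) n = ∏ j ∈ range n, (1 - q ^ (8 * j + 8)) :=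
  prod_congr rfl fun j _ => by rw [← pow_mul, mul_add, mul_one]

theorem prod_mul_gaussBinom {q : A} {M n k : ℕ} (hq : q ^ M = 0) (h₁ : M ≤ k) (h₂ : k + M ≤ n) :
    (∏ j ∈ range M, (1 - q ^ (8 * j + 8))) * gaussBinom (q ^ 8) n k = 1 := by
  have h := qFactorial_mul_gaussBinom (q ^ 8) n k (n - k) (by omega)
  simp only [qFactorial_pow_eight] at h
  rw [prod_range_eq_of_pow_eq_zero hq h₁ (by norm_num),
    prod_range_eq_of_pow_eq_zero hq (show M ≤ n - k by omega) (by norm_num),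
    prod_range_eq_of_pow_eq_zero hq (show M ≤ n by omega) (by norm_num)] at h
  have hu := isUnit_prod_one_sub_pow hq (range M) (fun j => 8 * j + 8) fun j => by omega
  apply hu.mul_left_cancel
  linear_combination h

theorem sum_mul_prod_eq {q : A} {M K : ℕ} (hq : q ^ M = 0) (hK : M ≤ K) (e k : ℕ → ℕ)
    (he : ∀ n, n ≤ e n) (hk : ∀ n < M, M ≤ k n ∧ k n + M ≤ 4 * M) (u : ℕ → A) :
    (∏ j ∈ range M, (1 - q ^ (8 * j + 8))) *
        ∑ n ∈ range K, u n * q ^ e n * gaussBinom (q ^ 8) (2 * M + 2 * M) (k n) =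
      ∑ n ∈ range M, u n * q ^ e n := by
  rw [mul_sum]
  symm
  have hz : ∀ n ∈ range K, n ∉ range M → (∏ j ∈ range M, (1 - q ^ (8 * j + 8))) *
      (u n * q ^ e n * gaussBinom (q ^ 8) (2 * M + 2 * M) (k n)) = 0 := by
    intro n _ hn
    rw [pow_eq_zero_of_le ((not_lt.1 fun h => hn (mem_range.2 h)).trans (he n)) hq]
    simp
  rw [← sum_subset (range_mono hK) hz]
  refine sum_congr rfl fun n hn => ?_
  obtain ⟨h₁, h₂⟩ := hk n (mem_range.1 hn)
  have := prod_mul_gaussBinom hq h₁ (show k n + M ≤ 2 * M + 2 * M by omega)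
  linear_combination -(u n * q ^ e n) * this

/-- The Jacobi triple product identity modulo the vanishing power of `q`. -/
theorem theta_eq_prod {q : A} {M : ℕ} (hq : q ^ M = 0) :
    ∑ n ∈ range M, (-1) ^ n * q ^ (4 * n ^ 2 + 3 * n) * (1 - q ^ (2 * n + 1)) =
      (∏ j ∈ range M, (1 - q ^ (8 * j + 1))) * (∏ j ∈ range M, (1 - q ^ (8 * j + 7))) *
        ∏ j ∈ range M, (1 - q ^ (8 * j + 8)) := by
  have h := finite_triple_product q (2 * M)
  rw [prod_range_eq_of_pow_eq_zero hq (show M ≤ 2 * M by omega) (by norm_num),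
    prod_range_eq_of_pow_eq_zero hq (show M ≤ 2 * M by omega) (by norm_num)] at h
  rw [h, mul_comm, mul_sub,
    sum_mul_prod_eq hq (by omega) (fun n => 4 * n ^ 2 + 3 * n) (fun n => 2 * M - n)
      (fun n => by nlinarith) (fun n hn => by omega) (fun n => (-1) ^ n),
    sum_mul_prod_eq hq (by omega) (fun n => 4 * n ^ 2 + 5 * n + 1) (fun n => 2 * M + 1 + n)
      (fun n => by nlinarith) (fun n hn => by omega) (fun n => (-1) ^ n), ← sum_sub_distrib]
  exact sum_congr rfl fun n _ => by ring

end TripleProduct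

section Assembly

variable {R : Type*} [CommRing R]

theorem prod_range_two_mul (f : ℕ → R) (N : ℕ) :
    ∏ j ∈ range (2 * N), f j = ∏ j ∈ range N, (f (2 * j) * f (2 * j + 1)) := by
  induction N with
  | zero => simp
  | succ N ih => rw [mul_add, mul_one, prod_range_succ, prod_range_succ, prod_range_succ, ih]; ring

theorem prod_range_four_mul (f : ℕ → R) (N : ℕ) :
    ∏ j ∈ range (4 * N), f j =
      ∏ j ∈ range N, (f (4 * j) * f (4 * j + 1) * f (4 * j + 2) * f (4 * j + 3)) := by
  rw [show 4 * N = 2 * (2 * N) by ring, prod_range_two_mul, prod_range_two_mul]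
  refine prod_congr rfl fun j _ => ?_
  ring_nf

theorem mul_prod_eq_one_of_recurrence {q : R} {M : ℕ} (hq : q ^ M = 0) (hM : 0 < M) (a : ℕ → R)
    (ha : ∀ i, a i = (1 + q ^ (2 * i + 1)) * a (i + 1) + q ^ (2 * i + 2) * a (i + 2))
    (ha' : ∀ i, M ≤ i → a i = 1) :
    a 1 * ∏ j ∈ range M,
      ((1 - q ^ (8 * j + 3)) * (1 - q ^ (8 * j + 4)) * (1 - q ^ (8 * j + 5))) = 1 := by
  have h := mul_prod_eq_of_recurrence hq hM a ha ha' 0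
  rw [sum_termA_zero hq, theta_eq_prod hq] at h
  have hodd : oddProd q M * ∏ j ∈ range M, (1 - q ^ (2 * j + 1)) =
      ∏ j ∈ range M, (1 - q ^ (4 * j + 2)) := by
    rw [oddProd, ← prod_mul_distrib]
    exact prod_congr rfl fun j _ => by ring
  rw [← prod_range_eq_of_pow_eq_zero (b := 2) hq (show M ≤ 2 * M by omega) four_pos,
    ← prod_range_eq_of_pow_eq_zero (b := 1) hq (show M ≤ 4 * M by omega) two_pos,
    prod_range_two_mul, prod_range_four_mul] at hodd
  rw [← prod_range_eq_of_pow_eq_zero (b := 2) hq (show M ≤ 4 * M by omega) two_pos,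
    prod_range_four_mul] at h
  simp only [mul_add, ← mul_assoc, add_assoc, Nat.reduceMul, Nat.reduceAdd, mul_one, zero_add,
    prod_mul_distrib] at h hodd ⊢
  have hu : ∀ b, 0 < b → IsUnit (∏ j ∈ range M, (1 - q ^ (8 * j + b))) := fun b hb =>
    isUnit_prod_one_sub_pow hq _ _ fun j => by omega
  set P : ℕ → R := fun b => ∏ j ∈ range M, (1 - q ^ (8 * j + b)) with hP
  have hU : IsUnit (P 1 * P 2 * P 6 * P 7 * P 8) :=
    ((((hu 1 one_pos).mul (hu 2 two_pos)).mul (hu 6 (by norm_num))).mul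
      (hu 7 (by norm_num))).mul (hu 8 (by norm_num))
  apply hU.mul_left_cancel
  linear_combination (P 1 * P 3 * P 5 * P 7) * h + (P 1 * P 7 * P 8) * hodd

theorem partSeries_residues_mul_prod (M : ℕ) :
    partSeries (fun m => ∀ a ∈ m, a ∈ (range (8 * M)).filter
        fun a => a % 8 = 3 ∨ a % 8 = 4 ∨ a % 8 = 5) *
      ∏ j ∈ range M,
        ((1 - X ^ (8 * j + 3)) * (1 - X ^ (8 * j + 4)) * (1 - X ^ (8 * j + 5))) = 1 := by
  have h := partSeries_mem_mul_prod
    ((range (8 * M)).filter fun a => a % 8 = 3 ∨ a % 8 = 4 ∨ a % 8 = 5) (by simp)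
  rw [prod_filter, show 8 * M = 2 * (4 * M) by ring, prod_range_two_mul, prod_range_four_mul] at h
  refine Eq.trans ?_ h
  rw [show 8 * M = 2 * (4 * M) by ring]
  congr 1
  refine prod_congr rfl fun j _ => ?_
  simp [mul_add, ← mul_assoc, add_assoc]

theorem partSeries_gapFrom_one :
    partSeries (GapFrom 1) =
      partSeries (fun m => ∀ a ∈ m, a % 8 = 3 ∨ a % 8 = 4 ∨ a % 8 = 5) := by
  rw [← sub_eq_zero]
  ext n
  refine X_pow_dvd_iff.1 ?_ n n.lt_succ_self
  set M := n + 1 with hM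
  set φ := Ideal.Quotient.mk (Ideal.span {(X : ℤ⟦X⟧) ^ M}) with hφ
  have hdvd : ∀ f, φ f = 0 ↔ X ^ M ∣ f := fun f => by
    rw [hφ, Ideal.Quotient.eq_zero_iff_mem, Ideal.mem_span_singleton]
  have hq : φ X ^ M = 0 := by rw [← map_pow, hdvd]
  have h₁ := mul_prod_eq_one_of_recurrence hq n.succ_pos (fun i => φ (partSeries (GapFrom i)))
    (fun i => by simpa using congrArg φ (partSeries_gapFrom i))
    (fun i hi => by
      rw [← sub_eq_zero, ← map_one φ, ← map_sub, hdvd]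
      exact X_pow_dvd_partSeries_gapFrom_sub_one hi)
  have h₂ := congrArg φ (partSeries_residues_mul_prod M)
  have h₃ : φ (partSeries (fun m => ∀ a ∈ m, a % 8 = 3 ∨ a % 8 = 4 ∨ a % 8 = 5)) =
      φ (partSeries (fun m => ∀ a ∈ m, a ∈ (range (8 * M)).filter
        fun a => a % 8 = 3 ∨ a % 8 = 4 ∨ a % 8 = 5)) := by
    rw [← sub_eq_zero, ← map_sub, hdvd]
    apply X_pow_dvd_partSeries_sub
    intro k hk p
    refine forall₂_congr fun a ha => ?_
    have := Nat.Partition.le_of_mem_parts ha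
    simp only [mem_filter, mem_range]
    omega
  rw [← hdvd, map_sub, sub_eq_zero, h₃]
  simp only [map_mul, map_prod, map_sub, map_one, map_pow] at h₂
  exact (IsUnit.of_mul_eq_one_right _ h₂).mul_right_cancel (h₁.trans h₂.symm)

end Assembly

end GoellnitzGordon

/-- Second Göllnitz–Gordon identity. -/
theorem goellnitz_gordon_second (n : ℕ) :
    {p : n.Partition | (∀ a ∈ p.parts, 3 ≤ a) ∧ gapCond p.parts}.ncard =
      {p : n.Partition | ∀ a ∈ p.parts, a % 8 = 3 ∨ a % 8 = 4 ∨ a % 8 = 5}.ncard := by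
  have h := congrArg (PowerSeries.coeff n) GoellnitzGordon.partSeries_gapFrom_one
  simpa [GoellnitzGordon.partSeries, GoellnitzGordon.GapFrom] using h
end

section
/- For every nonnegative integer n, the number of partitions of n with distinct odd parts, all odd parts ≥ 3, and smallest even part at least twice (number of parts + 1), equals the number of partitions of n into parts congruent to 3, 4, or 5 modulo 8. -/
open Finset

section QSeries

variable {R : Type*} [CommRing R]

/-- The `q`-Pochhammer symbol `(a; p)_n`. -/
def qPoch (a p : R) (n : ℕ) : R := ∏ i ∈ range n, (1 - a * p ^ i)

@[simp] lemma qPoch_zero (a p : R) : qPoch a p 0 = 1 := by simp [qPoch]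

lemma qPoch_succ (a p : R) (n : ℕ) : qPoch a p (n + 1) = qPoch a p n * (1 - a * p ^ n) :=
  prod_range_succ _ _

lemma qPoch_eq_of_le {a p : R} {n n' : ℕ} (h : ∀ i, n ≤ i → a * p ^ i = 0) (hn : n ≤ n') :
    qPoch a p n' = qPoch a p n := by
  induction n', hn using Nat.le_induction with
  | base => rfl
  | succ m hm ih => rw [qPoch_succ, h m hm, ih]; ring

lemma qPoch_two_mul (a p : R) (n : ℕ) :
    qPoch a p (2 * n) = qPoch a (p ^ 2) n * qPoch (a * p) (p ^ 2) n := by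
  induction n with
  | zero => simp
  | succ n ih =>
    rw [show 2 * (n + 1) = 2 * n + 1 + 1 by ring]
    simp only [qPoch_succ, ih]
    ring

lemma qPoch_neg_mul_qPoch (a p : R) (n : ℕ) :
    qPoch (-a) p n * qPoch a p n = qPoch (a ^ 2) (p ^ 2) n := by
  induction n with
  | zero => simp
  | succ n ih =>
    simp only [qPoch_succ, ← ih]
    ring

lemma isUnit_qPoch {a : R} (ha : IsNilpotent a) (p : R) (n : ℕ) : IsUnit (qPoch a p n) := by
  induction n with
  | zero => simp
  | succ n ih =>
    rw [qPoch_succ]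
    exact ih.mul ((Commute.all a (p ^ n)).isNilpotent_mul_right ha).isUnit_one_sub

lemma map_qPoch {S : Type*} [CommRing S] (f : R →+* S) (a p : R) (n : ℕ) :
    f (qPoch a p n) = qPoch (f a) (f p) n := by
  simp [qPoch]

/-- The Gaussian binomial coefficient with base `p`. -/
def gaussBinom (p : R) : ℕ → ℕ → R
  | _, 0 => 1
  | 0, _ + 1 => 0
  | n + 1, j + 1 => p ^ (j + 1) * gaussBinom p n (j + 1) + gaussBinom p n j

@[simp] lemma gaussBinom_zero_right (p : R) (n : ℕ) : gaussBinom p n 0 = 1 := by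
  cases n <;> rfl

lemma gaussBinom_succ_succ (p : R) (n j : ℕ) : gaussBinom p (n + 1) (j + 1) =
    p ^ (j + 1) * gaussBinom p n (j + 1) + gaussBinom p n j := rfl

lemma gaussBinom_eq_zero (p : R) {n j : ℕ} (h : n < j) : gaussBinom p n j = 0 := by
  induction n generalizing j with
  | zero => obtain ⟨j, rfl⟩ := Nat.exists_eq_succ_of_ne_zero h.ne'; rfl
  | succ n ih =>
    obtain ⟨j, rfl⟩ := Nat.exists_eq_succ_of_ne_zero (Nat.ne_zero_of_lt h)
    rw [Nat.succ_eq_add_one, gaussBinom_succ_succ, ih (by omega), ih (by omega)]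
    ring

lemma gaussBinom_self (p : R) (n : ℕ) : gaussBinom p n n = 1 := by
  induction n with
  | zero => rfl
  | succ n ih => rw [gaussBinom_succ_succ, ih, gaussBinom_eq_zero p (Nat.lt_succ_self n)]; ring

lemma map_gaussBinom {S : Type*} [CommRing S] (f : R →+* S) (p : R) (n j : ℕ) :
    f (gaussBinom p n j) = gaussBinom (f p) n j := by
  induction n generalizing j with
  | zero => cases j <;> simp [gaussBinom]
  | succ n ih => cases j <;> simp [gaussBinom, ih]

lemma gaussBinom_mul_qPoch (p : R) (a b : ℕ) :
    gaussBinom p (a + b) a * (qPoch p p a * qPoch p p b) = qPoch p p (a + b) := by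
  induction a generalizing b with
  | zero => simp
  | succ a iha =>
    induction b with
    | zero => simp [gaussBinom_self]
    | succ b ihb =>
      have h := iha (b + 1)
      rw [show a + 1 + (b + 1) = a + b + 1 + 1 by ring, gaussBinom_succ_succ,
        qPoch_succ p p (a + b + 1)]
      rw [show a + 1 + b = a + b + 1 by ring] at ihb
      rw [show a + (b + 1) = a + b + 1 by ring] at h
      rw [qPoch_succ p p a] at *
      rw [qPoch_succ p p b] at *
      linear_combination p ^ (a + 1) * (1 - p * p ^ b) * ihb + (1 - p * p ^ a) * h

/-- The `q`-binomial theorem. -/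
lemma prod_add_mul_pow (p a b : R) (n : ℕ) : ∏ i ∈ range n, (a + b * p ^ i) =
    ∑ j ∈ range (n + 1), gaussBinom p n j * p ^ (j.choose 2) * a ^ (n - j) * b ^ j := by
  induction n generalizing b with
  | zero => simp
  | succ n ih =>
    have h1 : ∏ i ∈ range (n + 1), (a + b * p ^ i) =
        (a + b) * ∏ i ∈ range n, (a + b * p * p ^ i) := by
      rw [prod_range_succ']
      simp only [pow_succ, pow_zero, mul_one]
      rw [mul_comm]
      congr 1
      exact prod_congr rfl fun i _ => by ring
    rw [h1, ih, sum_range_succ' _ (n + 1), add_mul]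
    have h2 : ∀ j ∈ range (n + 1), gaussBinom p (n + 1) (j + 1) * p ^ ((j + 1).choose 2) *
        a ^ (n + 1 - (j + 1)) * b ^ (j + 1) =
        a ^ (n - j) * (gaussBinom p n (j + 1) * p ^ ((j + 1).choose 2) * (b * p) ^ (j + 1)) +
        b * (gaussBinom p n j * p ^ (j.choose 2) * a ^ (n - j) * (b * p) ^ j) := by
      intro j _
      rw [gaussBinom_succ_succ, Nat.choose_succ_succ' j 1, Nat.choose_one_right,
        Nat.add_sub_add_right]
      ring
    have h3 : ∀ j ∈ range n, a ^ (n - j) * (gaussBinom p n (j + 1) * p ^ ((j + 1).choose 2) *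
        (b * p) ^ (j + 1)) = a * (gaussBinom p n (j + 1) * p ^ ((j + 1).choose 2) *
        a ^ (n - (j + 1)) * (b * p) ^ (j + 1)) := by
      intro j hj
      have : n - j = n - (j + 1) + 1 := by have := mem_range.1 hj; omega
      rw [this]; ring
    have h4 : a * ∑ j ∈ range (n + 1), gaussBinom p n j * p ^ (j.choose 2) * a ^ (n - j) *
        (b * p) ^ j = (∑ j ∈ range (n + 1), a ^ (n - j) * (gaussBinom p n (j + 1) *
        p ^ ((j + 1).choose 2) * (b * p) ^ (j + 1))) + a ^ (n + 1) := by
      rw [sum_range_succ' _ n, sum_range_succ _ n, gaussBinom_eq_zero p (Nat.lt_succ_self n),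
        sum_congr rfl h3, ← mul_sum]
      simp
      ring
    rw [sum_congr rfl h2, sum_add_distrib, ← mul_sum, h4]
    simp
    ring

/-- A Gaussian binomial coefficient stabilises to `1 / (p; p)_∞`. -/
lemma pow_mul_gaussBinom_mul_qPoch {y p : R} (hp : IsNilpotent p) {a b : ℕ}
    (ha : ∀ i, a < i → y * p ^ i = 0) (hb : ∀ i, b < i → y * p ^ i = 0) :
    y * (gaussBinom p (a + b) a * qPoch p p (a + b)) = y := by
  have key : ∀ c d, (∀ i, c < i → y * p ^ i = 0) →
      y * qPoch p p (c + d) = y * qPoch p p c := by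
    intro c d h
    induction d with
    | zero => rfl
    | succ d ih =>
      rw [← add_assoc, qPoch_succ]
      linear_combination ih - qPoch p p (c + d) * h (c + d + 1) (by omega)
  have h1 := key a b ha
  have h2 := key b a hb
  rw [add_comm b a] at h2
  refine (isUnit_qPoch hp p (a + b)).mul_right_cancel ?_
  linear_combination gaussBinom p (a + b) a * qPoch p p (a + b) * h1 +
    gaussBinom p (a + b) a * qPoch p p a * h2 + y * gaussBinom_mul_qPoch p a b

open Polynomial in
/-- A finite form of the Jacobi triple product for the theta series with exponents
`4 n ^ 2 + 3 n`. -/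
lemma qPoch_mul_qPoch_polynomial (M : ℕ) :
    (qPoch X (X ^ 8) M * qPoch (X ^ 7) (X ^ 8) M : ℤ[X]) =
      ∑ n ∈ range (M + 1), (-1) ^ n * X ^ (4 * n ^ 2 + 3 * n) *
        gaussBinom (X ^ 8) (2 * M) (M - n) -
      ∑ n ∈ range M, (-1) ^ n * X ^ (4 * n ^ 2 + 5 * n + 1) *
        gaussBinom (X ^ 8) (2 * M) (M + n + 1) := by
  rcases Nat.eq_zero_or_pos M with rfl | hM
  · simp
  obtain ⟨K, hK⟩ : ∃ K, K + 5 * M = 12 * M ^ 2 := ⟨12 * M ^ 2 - 5 * M, by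
    have : 5 * M ≤ 12 * M ^ 2 := by nlinarith
    omega⟩
  have hprod : ∏ i ∈ range (2 * M), ((X : ℤ[X]) ^ (8 * M - 1) + (-1) * (X ^ 8) ^ i) =
      (-1) ^ M * X ^ K * (qPoch X (X ^ 8) M * qPoch (X ^ 7) (X ^ 8) M) := by
    rw [two_mul, prod_range_add]
    have e1 : ∏ i ∈ range M, ((X : ℤ[X]) ^ (8 * M - 1) + (-1) * (X ^ 8) ^ i) =
        (-1) ^ M * X ^ (4 * M * (M - 1)) * qPoch (X ^ 7) (X ^ 8) M := by
      have : ∀ i ∈ range M, ((X : ℤ[X]) ^ (8 * M - 1) + (-1) * (X ^ 8) ^ i) =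
          (-1) * (X ^ (8 * i)) * (1 - X ^ 7 * (X ^ 8) ^ (M - 1 - i)) := by
        intro i hi
        obtain ⟨c, rfl⟩ : ∃ c, M = i + 1 + c := ⟨M - (i + 1), by have := mem_range.1 hi; omega⟩
        rw [show 8 * (i + 1 + c) - 1 = 8 * i + 7 + 8 * c by omega,
          show i + 1 + c - 1 - i = c by omega]
        ring
      rw [prod_congr rfl this, prod_mul_distrib, prod_mul_distrib,
        prod_range_reflect (fun i => 1 - (X : ℤ[X]) ^ 7 * (X ^ 8) ^ i) M, prod_pow_eq_pow_sum,
        ← mul_sum, prod_const, card_range, qPoch]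
      congr 3
      have := sum_range_id_mul_two M
      rw [mul_assoc, ← this]
      ring
    have e2 : ∏ i ∈ range M, ((X : ℤ[X]) ^ (8 * M - 1) + (-1) * (X ^ 8) ^ (M + i)) =
        X ^ ((8 * M - 1) * M) * qPoch X (X ^ 8) M := by
      have : ∀ i ∈ range M, ((X : ℤ[X]) ^ (8 * M - 1) + (-1) * (X ^ 8) ^ (M + i)) =
          X ^ (8 * M - 1) * (1 - X * (X ^ 8) ^ i) := by
        intro i _
        obtain ⟨c, hc⟩ : ∃ c, 8 * M = c + 1 := ⟨8 * M - 1, by omega⟩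
        rw [hc, pow_add (X ^ 8), ← pow_mul X 8 M, hc, Nat.add_sub_cancel]
        ring
      rw [prod_congr rfl this, prod_mul_distrib, prod_const, card_range, ← pow_mul, qPoch]
    rw [e1, e2]
    have : K = 4 * M * (M - 1) + (8 * M - 1) * M := by
      obtain ⟨c, rfl⟩ : ∃ c, M = c + 1 := ⟨M - 1, by omega⟩
      rw [show 8 * (c + 1) - 1 = 8 * c + 7 by omega, Nat.add_sub_cancel]
      nlinarith
    rw [this]
    ring
  have hsum : ∑ j ∈ range (2 * M + 1), gaussBinom ((X : ℤ[X]) ^ 8) (2 * M) j *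
      (X ^ 8) ^ (j.choose 2) * (X ^ (8 * M - 1)) ^ (2 * M - j) * (-1) ^ j =
      (-1) ^ M * X ^ K * (∑ n ∈ range (M + 1), (-1) ^ n * X ^ (4 * n ^ 2 + 3 * n) *
          gaussBinom (X ^ 8) (2 * M) (M - n) -
        ∑ n ∈ range M, (-1) ^ n * X ^ (4 * n ^ 2 + 5 * n + 1) *
          gaussBinom (X ^ 8) (2 * M) (M + n + 1)) := by
    have hch : ∀ j, j.choose 2 * 2 + j = j * j := fun j => by
      have := Nat.choose_two_right j
      have h2 := Nat.div_mul_cancel (Nat.even_mul_pred_self j).two_dvd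
      rw [this, h2]
      cases j <;> simp
      ring
    rw [show 2 * M + 1 = (M + 1) + M by ring, sum_range_add, ← sum_range_reflect _ (M + 1),
      mul_sub, mul_sum, mul_sum, sub_eq_add_neg, ← sum_neg_distrib]
    congr 1
    · refine sum_congr rfl fun n hn => ?_
      obtain ⟨c, rfl⟩ : ∃ c, M = n + c := ⟨M - n, by have := mem_range.1 hn; omega⟩
      rw [show n + c + 1 - 1 - n = c by omega, show n + c - n = c by omega,
        show 2 * (n + c) - c = 2 * n + c by omega]
      have he : 8 * c.choose 2 + (8 * (n + c) - 1) * (2 * n + c) = K + (4 * n ^ 2 + 3 * n) := by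
        have := hch c
        obtain ⟨t, ht⟩ : ∃ t, 8 * (n + c) = t + 1 := ⟨8 * (n + c) - 1, by omega⟩
        rw [ht, Nat.add_sub_cancel]
        zify at *
        have ht' : (t : ℤ) = 8 * (n + c) - 1 := by linarith
        rw [ht']
        linear_combination 4 * this - hK
      have hs : ((-1 : ℤ[X])) ^ c = (-1) ^ (n + c) * (-1) ^ n := by
        rw [← pow_add, show n + c + n = c + 2 * n by ring, pow_add, pow_mul]; simp
      rw [← pow_mul X 8, ← pow_mul X, hs]
      have := congrArg (fun k => (X : ℤ[X]) ^ k) he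
      simp only [pow_add] at this ⊢
      linear_combination (gaussBinom ((X : ℤ[X]) ^ 8) (2 * (n + c)) c) *
        ((-1) ^ n * (-1) ^ c * (-1) ^ n) * this
    · refine sum_congr rfl fun n hn => ?_
      obtain ⟨c, rfl⟩ : ∃ c, M = n + 1 + c := ⟨M - (n + 1), by have := mem_range.1 hn; omega⟩
      rw [show n + 1 + c + 1 + n = n + 1 + c + n + 1 by ring,
        show 2 * (n + 1 + c) - (n + 1 + c + n + 1) = c by omega]
      have he : 8 * (n + 1 + c + n + 1).choose 2 + (8 * (n + 1 + c) - 1) * c =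
          K + (4 * n ^ 2 + 5 * n + 1) := by
        have := hch (n + 1 + c + n + 1)
        rw [show 8 * (n + 1 + c) - 1 = 8 * (n + c) + 7 by omega]
        zify at *
        linear_combination 4 * this - hK
      rw [← pow_mul X 8, ← pow_mul X]
      have := congrArg (fun k => (X : ℤ[X]) ^ k) he
      simp only [pow_add] at this ⊢
      have hs : ((-1 : ℤ[X])) ^ n * (-1) ^ n = 1 := by
        rw [← mul_pow]; simp
      linear_combination (gaussBinom ((X : ℤ[X]) ^ 8) (2 * (n + 1 + c)) (n + 1 + c + n + 1)) *
        ((-1) ^ n * (-1) ^ c * (-1) ^ n) * this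
  have h := prod_add_mul_pow ((X : ℤ[X]) ^ 8) (X ^ (8 * M - 1)) (-1) (2 * M)
  rw [hprod, hsum] at h
  refine mul_left_cancel₀ ?_ h
  exact mul_ne_zero (pow_ne_zero _ (by simp)) (pow_ne_zero _ X_ne_zero)

end QSeries

section Truncated

variable {R : Type*} [CommRing R] {x : R} {N : ℕ}

lemma pow_eq_zero_of_pow_eq_zero_of_le (hx : x ^ N = 0) {n : ℕ} (h : N ≤ n) : x ^ n = 0 := by
  rw [← Nat.sub_add_cancel h, pow_add, hx, mul_zero]

lemma qPoch_mul_qPoch_mul_qPoch (hx : x ^ N = 0) :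
    qPoch x (x ^ 8) N * qPoch (x ^ 7) (x ^ 8) N * qPoch (x ^ 8) (x ^ 8) (2 * N) =
      ∑ n ∈ range N, (-1) ^ n * x ^ (4 * n ^ 2 + 3 * n) * (1 - x ^ (2 * n + 1)) := by
  have hnil : IsNilpotent (x ^ 8) := ⟨N, by rw [← pow_mul, mul_comm, pow_mul, hx]; simp⟩
  have h := congrArg (Polynomial.aeval x : Polynomial ℤ →ₐ[ℤ] R).toRingHom
    (qPoch_mul_qPoch_polynomial N)
  simp only [map_mul, map_qPoch, map_sub, map_sum, map_gaussBinom, map_pow, map_neg, map_one,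
    AlgHom.toRingHom_eq_coe, RingHom.coe_coe, Polynomial.aeval_X] at h
  rw [h, sub_mul, sum_mul, sum_mul, sum_range_succ]
  have h0 : x ^ (4 * N ^ 2 + 3 * N) = 0 := pow_eq_zero_of_pow_eq_zero_of_le hx (by nlinarith)
  rw [h0, mul_zero, zero_mul, zero_mul, add_zero, ← sum_sub_distrib]
  refine sum_congr rfl fun n hn => ?_
  have hn' := mem_range.1 hn
  have h1 := pow_mul_gaussBinom_mul_qPoch (y := x ^ (4 * n ^ 2 + 3 * n)) hnil
    (a := N - n) (b := N + n)
    (fun i hi => by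
      rw [← pow_mul, ← pow_add]
      exact pow_eq_zero_of_pow_eq_zero_of_le hx (by nlinarith [show N < i + n by omega]))
    (fun i hi => by
      rw [← pow_mul, ← pow_add]
      exact pow_eq_zero_of_pow_eq_zero_of_le hx (by nlinarith))
  have h2 := pow_mul_gaussBinom_mul_qPoch (y := x ^ (4 * n ^ 2 + 5 * n + 1)) hnil
    (a := N + n + 1) (b := N - n - 1)
    (fun i hi => by
      rw [← pow_mul, ← pow_add]
      exact pow_eq_zero_of_pow_eq_zero_of_le hx (by nlinarith))
    (fun i hi => by
      rw [← pow_mul, ← pow_add]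
      exact pow_eq_zero_of_pow_eq_zero_of_le hx (by nlinarith [show N ≤ i + n by omega]))
  rw [show N - n + (N + n) = 2 * N by omega] at h1
  rw [show N + n + 1 + (N - n - 1) = 2 * N by omega] at h2
  linear_combination (-1) ^ n * h1 - (-1) ^ n * h2

/-- The `n`-th term of the series solution of the Göllnitz–Gordon `q`-difference equation,
in terms of sequences `P`, `E`, `S`, `D` standing for `(x²; x²)_n`, `1 / (x²; x²)_n`,
`(-x; x²)_n` and `1 / (-x; x²)_n`. -/
def gordonTerm (x : R) (P E S D : ℕ → R) (k n : ℕ) : R :=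
  (-1) ^ n * x ^ (4 * n ^ 2 + 4 * n * k + 3 * n) * (1 - x ^ (2 * (2 * n + k + 1))) *
    (P (n + k) * E n * S n * D (n + k + 1))

/-- The telescoping certificate for `gordonTerm`. -/
def gordonCert (x : R) (P E S D : ℕ → R) (k n : ℕ) : R :=
  -((-1) ^ n * x ^ (4 * n ^ 2 + 4 * n * k + 3 * n) * (1 - x ^ (2 * n)) *
    (1 + x ^ (2 * n) + x ^ (2 * n + 2 * k + 3) - x ^ (4 * n + 2 * k + 2)) *
    (P (n + k) * E n * S n * D (n + k + 2)))

lemma gordonTerm_telescope {P E S D : ℕ → R}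
    (hP : ∀ n, P (n + 1) = P n * (1 - x ^ (2 * n + 2)))
    (hE : ∀ n, E n = E (n + 1) * (1 - x ^ (2 * n + 2)))
    (hS : ∀ n, S (n + 1) = S n * (1 + x ^ (2 * n + 1)))
    (hD : ∀ n, D n = D (n + 1) * (1 + x ^ (2 * n + 1))) (k n : ℕ) :
    gordonTerm x P E S D k n - (1 + x ^ (2 * k + 3)) * gordonTerm x P E S D (k + 1) n -
      x ^ (2 * k + 4) * gordonTerm x P E S D (k + 2) n =
    gordonCert x P E S D k (n + 1) - gordonCert x P E S D k n := by
  simp only [gordonTerm, gordonCert]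
  rw [show n + 1 + k = n + k + 1 by ring, show n + (k + 2) = n + k + 1 + 1 by ring,
    show n + (k + 1) = n + k + 1 by ring, hP (n + k + 1), hP (n + k), hS n, hE n,
    hD (n + k + 1), hD (n + k + 1 + 1)]
  ring

lemma sum_gordonTerm (hx : x ^ N = 0) {P E S D : ℕ → R}
    (hP : ∀ n, P (n + 1) = P n * (1 - x ^ (2 * n + 2)))
    (hE : ∀ n, E n = E (n + 1) * (1 - x ^ (2 * n + 2)))
    (hS : ∀ n, S (n + 1) = S n * (1 + x ^ (2 * n + 1)))
    (hD : ∀ n, D n = D (n + 1) * (1 + x ^ (2 * n + 1))) (k : ℕ) :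
    ∑ n ∈ range N, gordonTerm x P E S D k n =
      (1 + x ^ (2 * k + 3)) * ∑ n ∈ range N, gordonTerm x P E S D (k + 1) n +
      x ^ (2 * k + 4) * ∑ n ∈ range N, gordonTerm x P E S D (k + 2) n := by
  have h := sum_range_sub (gordonCert x P E S D k) N
  rw [← sum_congr rfl fun n _ => gordonTerm_telescope hP hE hS hD k n, sum_sub_distrib,
    sum_sub_distrib, ← mul_sum, ← mul_sum] at h
  have h0 : gordonCert x P E S D k 0 = 0 := by simp [gordonCert]
  have hN : gordonCert x P E S D k N = 0 := by
    rw [gordonCert, pow_eq_zero_of_pow_eq_zero_of_le hx (by nlinarith)]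
    ring
  rw [h0, hN] at h
  linear_combination h

/-- The solution of the Göllnitz–Gordon `q`-difference equation tending to `1`. -/
theorem mul_qPoch_eq_of_recurrence (hx : x ^ N = 0) {C : ℕ → R}
    (hC : ∀ k, C k = (1 + x ^ (2 * k + 3)) * C (k + 1) + x ^ (2 * k + 4) * C (k + 2))
    (hC1 : ∀ k, N ≤ k → C k = 1) :
    C 0 * qPoch (x ^ 2) (x ^ 2) N = qPoch (-x) (x ^ 2) N *
      ∑ n ∈ range N, (-1) ^ n * x ^ (4 * n ^ 2 + 3 * n) * (1 - x ^ (2 * n + 1)) := by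
  have hnil : IsNilpotent x := ⟨N, hx⟩
  set P := qPoch (x ^ 2) (x ^ 2) with hPdef
  set S := qPoch (-x) (x ^ 2) with hSdef
  set E : ℕ → R := fun n => Ring.inverse (P n) with hEdef
  set D : ℕ → R := fun n => Ring.inverse (S n) with hDdef
  have hPu : ∀ n, IsUnit (P n) := isUnit_qPoch (hnil.pow_of_pos two_ne_zero) _
  have hSu : ∀ n, IsUnit (S n) := isUnit_qPoch hnil.neg _
  have hPE : ∀ n, P n * E n = 1 := fun n => Ring.mul_inverse_cancel _ (hPu n)
  have hSD : ∀ n, S n * D n = 1 := fun n => Ring.mul_inverse_cancel _ (hSu n)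
  have hP : ∀ n, P (n + 1) = P n * (1 - x ^ (2 * n + 2)) := fun n => by
    rw [hPdef, qPoch_succ]; ring
  have hS : ∀ n, S (n + 1) = S n * (1 + x ^ (2 * n + 1)) := fun n => by
    rw [hSdef, qPoch_succ]; ring
  have hE : ∀ n, E n = E (n + 1) * (1 - x ^ (2 * n + 2)) := fun n => by
    linear_combination (-E n) * hPE (n + 1) + E (n + 1) * (1 - x ^ (2 * n + 2)) * hPE n +
      E n * E (n + 1) * hP n
  have hD : ∀ n, D n = D (n + 1) * (1 + x ^ (2 * n + 1)) := fun n => by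
    linear_combination (-D n) * hSD (n + 1) + D (n + 1) * (1 + x ^ (2 * n + 1)) * hSD n +
      D n * D (n + 1) * hS n
  have hPN : ∀ n, N ≤ n → P n = P N := fun n hn => qPoch_eq_of_le (fun i hi => by
    rw [← pow_mul, ← pow_add]; exact pow_eq_zero_of_pow_eq_zero_of_le hx (by omega)) hn
  have hSN : ∀ n, N ≤ n → S n = S N := fun n hn => qPoch_eq_of_le (fun i hi => by
    rw [← pow_mul, neg_mul, ← pow_succ', pow_eq_zero_of_pow_eq_zero_of_le hx (by omega),
      neg_zero]) hn
  have key : ∀ d k, N ≤ k + d →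
      C k * P N = S N * ∑ n ∈ range N, gordonTerm x P E S D k n := by
    intro d
    induction d using Nat.strong_induction_on with
    | _ d ih =>
      intro k hk
      rcases Nat.eq_zero_or_pos d with rfl | hd
      · have hz : ∀ n ∈ range N, n ≠ 0 → gordonTerm x P E S D k n = 0 := by
          intro n _ hn
          have : 0 < n := Nat.pos_of_ne_zero hn
          rw [gordonTerm, pow_eq_zero_of_pow_eq_zero_of_le hx (by nlinarith)]
          ring
        rcases Nat.eq_zero_or_pos N with rfl | hN
        · have : (1 : R) = 0 := by simpa using hx
          rw [← mul_one (C k * P 0), ← mul_one (S 0 * _), this, mul_zero, mul_zero]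
        · rw [sum_eq_single 0 hz (fun h => absurd (mem_range.2 hN) h), hC1 k (by omega),
            gordonTerm, ← hSN (k + 1) (by omega), ← hPN (k + 1) (by omega), hP k]
          have e0 : E 0 = 1 := by simpa [hPdef] using hPE 0
          have s0 : S 0 = 1 := by simp [hSdef]
          simp only [zero_add, e0, s0]
          linear_combination (-P k * (1 - x ^ (2 * k + 2))) * hSD (k + 1)
      · have h1 := ih (d - 1) (by omega) (k + 1) (by omega)
        have h2 := ih (d - 1) (by omega) (k + 2) (by omega)
        rw [hC k, sum_gordonTerm hx hP hE hS hD k]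
        linear_combination (1 + x ^ (2 * k + 3)) * h1 + x ^ (2 * k + 4) * h2
  rw [key N 0 (by omega)]
  congr 1
  refine sum_congr rfl fun n _ => ?_
  rw [gordonTerm]
  simp only [add_zero, mul_zero]
  have h1 := hSD (n + 1)
  rw [hS] at h1
  linear_combination (-1) ^ n * x ^ (4 * n ^ 2 + 3 * n) * (1 - x ^ (2 * (2 * n + 1))) *
    S n * D (n + 1) * hPE n + (-1) ^ n * x ^ (4 * n ^ 2 + 3 * n) * (1 - x ^ (2 * n + 1)) * h1

theorem mul_prod_eq_one_of_recurrence (hx : x ^ N = 0) {C : ℕ → R}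
    (hC : ∀ k, C k = (1 + x ^ (2 * k + 3)) * C (k + 1) + x ^ (2 * k + 4) * C (k + 2))
    (hC1 : ∀ k, N ≤ k → C k = 1) :
    C 0 * (qPoch (x ^ 3) (x ^ 8) N * qPoch (x ^ 4) (x ^ 8) N * qPoch (x ^ 5) (x ^ 8) N) = 1 := by
  have hnil : IsNilpotent x := ⟨N, hx⟩
  have stab : ∀ i j, 0 < i → 0 < j →
      qPoch (x ^ i) (x ^ j) (2 * N) = qPoch (x ^ i) (x ^ j) N := fun i j hi hj =>
    qPoch_eq_of_le (fun l hl => by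
      rw [← pow_mul, ← pow_add]
      exact pow_eq_zero_of_pow_eq_zero_of_le hx (by nlinarith)) (by omega)
  have split : ∀ i j, 0 < i → 0 < j → qPoch (x ^ i) (x ^ j) N =
      qPoch (x ^ i) (x ^ (j * 2)) N * qPoch (x ^ (i + j)) (x ^ (j * 2)) N := by
    intro i j hi hj
    rw [← stab i j hi hj, qPoch_two_mul, ← pow_mul, ← pow_add]
  have unit : ∀ i j, 0 < i → IsUnit (qPoch (x ^ i) (x ^ j) N) := fun i j hi =>
    isUnit_qPoch (hnil.pow_of_pos hi.ne') _ _
  have h1 := mul_qPoch_eq_of_recurrence hx hC hC1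
  rw [← qPoch_mul_qPoch_mul_qPoch hx, stab 8 8 (by omega) (by omega)] at h1
  have h2 := qPoch_neg_mul_qPoch x (x ^ 2) N
  have s1 := split 1 2 (by omega) (by omega)
  have s2 := split 1 4 (by omega) (by omega)
  have s3 := split 3 4 (by omega) (by omega)
  have s4 := split 2 2 (by omega) (by omega)
  have s5 := split 4 4 (by omega) (by omega)
  norm_num [← pow_mul] at s1 s2 s3 s4 s5 h2
  have u := (((unit 1 8 (by omega)).mul (unit 7 8 (by omega))).mul (unit 8 8 (by omega))).mul
    (unit 2 4 (by omega))
  rw [pow_one] at u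
  refine u.mul_left_cancel ?_
  rw [s1, s2, s3] at h2
  rw [s4, s5] at h1
  linear_combination qPoch x (x ^ 8) N * qPoch (x ^ 5) (x ^ 8) N * qPoch (x ^ 3) (x ^ 8) N *
    qPoch (x ^ 7) (x ^ 8) N * h1 +
    qPoch x (x ^ 8) N * qPoch (x ^ 7) (x ^ 8) N * qPoch (x ^ 8) (x ^ 8) N * h2

end Truncated

section Counting

/-- The number of multisets of positive integers with sum `n` that satisfy `P`. -/
noncomputable def sumCount (P : Multiset ℕ → Prop) (n : ℕ) : ℕ :=
  {m : Multiset ℕ | (0 ∉ m ∧ P m) ∧ m.sum = n}.ncard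

lemma ncard_partition_eq_sumCount (P : Multiset ℕ → Prop) (n : ℕ) :
    {p : n.Partition | P p.parts}.ncard = sumCount P n := by
  have : {m : Multiset ℕ | (0 ∉ m ∧ P m) ∧ m.sum = n} =
      Nat.Partition.parts '' {p : n.Partition | P p.parts} := by
    ext m
    constructor
    · rintro ⟨⟨h0, hP⟩, hs⟩
      exact ⟨⟨m, fun {i} hi => Nat.pos_of_ne_zero fun h => h0 (h ▸ hi), hs⟩, hP, rfl⟩
    · rintro ⟨p, hp, rfl⟩
      exact ⟨⟨fun h => (p.parts_pos h).ne rfl, hp⟩, p.parts_sum⟩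
  rw [sumCount, this, Set.ncard_image_of_injective _ fun p p' h => Nat.Partition.ext h]

lemma finite_sum_eq (P : Multiset ℕ → Prop) (n : ℕ) :
    {m : Multiset ℕ | (0 ∉ m ∧ P m) ∧ m.sum = n}.Finite := by
  refine (Set.finite_range (Nat.Partition.parts (n := n))).subset ?_
  rintro m ⟨⟨h0, -⟩, hs⟩
  exact ⟨⟨m, fun {i} hi => Nat.pos_of_ne_zero fun h => h0 (h ▸ hi), hs⟩, rfl⟩

/-- A map of multisets raising the sum by `a` shifts the counting function by `a`. -/
lemma ncard_image_sum_eq {Q : Multiset ℕ → Prop} {f : Multiset ℕ → Multiset ℕ} {a : ℕ}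
    (hinj : Set.InjOn f {m | 0 ∉ m ∧ Q m})
    (hsum : ∀ m, 0 ∉ m → Q m → (f m).sum = m.sum + a) (n : ℕ) :
    {m | m ∈ f '' {m | 0 ∉ m ∧ Q m} ∧ m.sum = n}.ncard =
      if a ≤ n then sumCount Q (n - a) else 0 := by
  split_ifs with h
  · have : {m | m ∈ f '' {m | 0 ∉ m ∧ Q m} ∧ m.sum = n} =
        f '' {m : Multiset ℕ | (0 ∉ m ∧ Q m) ∧ m.sum = n - a} := by
      ext m
      constructor
      · rintro ⟨⟨m', hm', rfl⟩, hs⟩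
        have := hsum m' hm'.1 hm'.2
        exact ⟨m', ⟨hm', by omega⟩, rfl⟩
      · rintro ⟨m', ⟨hm', hs⟩, rfl⟩
        have := hsum m' hm'.1 hm'.2
        exact ⟨⟨m', hm', rfl⟩, by omega⟩
    rw [this, (hinj.mono fun m hm => hm.1).ncard_image, sumCount]
  · convert Set.ncard_empty (Multiset ℕ)
    ext m
    simp only [Set.mem_ofPred_eq, Set.mem_empty_iff_false, iff_false, not_and]
    rintro ⟨m', hm', rfl⟩ hs
    have := hsum m' hm'.1 hm'.2
    omega

/-- Multisets with distinct odd parts, all at least `2 k + 1`, whose even parts are at least twice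
`k` plus the number of parts. -/
def companion (k : ℕ) (m : Multiset ℕ) : Prop :=
  distinctOddParts m ∧ minOddGe m (2 * k + 1) ∧ minEvenGe m (2 * (Multiset.card m + k))

/-- Subtract `2` from every part and insert the least even part `companion k` allows. -/
def insertEven (k : ℕ) (m : Multiset ℕ) : Multiset ℕ :=
  (2 * (Multiset.card m + 1 + k)) ::ₘ m.map (· - 2)

lemma companion_succ_le {k : ℕ} {m : Multiset ℕ} (h : companion (k + 1) m) : companion k m :=
  ⟨h.1, fun a ha ho => by have := h.2.1 a ha ho; omega,
    fun a ha he => by have := h.2.2 a ha he; omega⟩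

lemma distinctOddParts_cons {a : ℕ} {m : Multiset ℕ} :
    distinctOddParts (a ::ₘ m) ↔ distinctOddParts m ∧ (Odd a → a ∉ m) := by
  constructor
  · refine fun h => ⟨fun b hb => (Multiset.count_le_count_cons b a m).trans (h b hb), fun ha => ?_⟩
    have := h a ha
    rw [Multiset.count_cons_self] at this
    exact Multiset.count_eq_zero.1 (by omega)
  · rintro ⟨h, ha⟩ b hb
    by_cases hab : b = a
    · subst hab
      rw [Multiset.count_cons_self, Multiset.count_eq_zero.2 (ha hb)]
    · rw [Multiset.count_cons_of_ne hab]
      exact h b hb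

lemma companion_cons_odd {k : ℕ} {m : Multiset ℕ} :
    companion k ((2 * k + 1) ::ₘ m) ↔ companion (k + 1) m := by
  have hodd : Odd (2 * k + 1) := ⟨k, rfl⟩
  constructor
  · rintro ⟨h1, h2, h3⟩
    rw [distinctOddParts_cons] at h1
    refine ⟨h1.1, fun a ha ho => ?_, fun a ha he => ?_⟩
    · have := h2 a (Multiset.mem_cons_of_mem ha) ho
      have hne : a ≠ 2 * k + 1 := fun h => h1.2 hodd (h ▸ ha)
      obtain ⟨t, rfl⟩ := ho
      omega
    · have := h3 a (Multiset.mem_cons_of_mem ha) he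
      rw [Multiset.card_cons] at this
      omega
  · rintro ⟨h1, h2, h3⟩
    refine ⟨distinctOddParts_cons.2 ⟨h1, fun _ hm => ?_⟩, fun a ha ho => ?_, fun a ha he => ?_⟩
    · have := h2 _ hm hodd
      omega
    · rcases Multiset.mem_cons.1 ha with rfl | ha
      · exact le_rfl
      · have := h2 a ha ho
        omega
    · rcases Multiset.mem_cons.1 ha with rfl | ha
      · exact absurd he (Nat.not_even_iff_odd.2 hodd)
      · have := h3 a ha he
        rw [Multiset.card_cons]
        omega

lemma two_lt_of_companion {k : ℕ} {m : Multiset ℕ} (h : companion (k + 2) m) {a : ℕ}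
    (ha : a ∈ m) : 2 < a := by
  rcases Nat.even_or_odd a with he | ho
  · have := h.2.2 a ha he
    omega
  · have := h.2.1 a ha ho
    omega

lemma map_add_map_sub {m : Multiset ℕ} (h : ∀ a ∈ m, 2 < a) :
    (m.map (· - 2)).map (· + 2) = m := by
  rw [Multiset.map_map]
  conv_rhs => rw [← Multiset.map_id' m]
  exact Multiset.map_congr rfl fun a ha => Nat.sub_add_cancel (h a ha).le

lemma companion_insertEven {k : ℕ} {m : Multiset ℕ} (h : companion (k + 2) m) :
    companion k (insertEven k m) ∧ 2 * k + 1 ∉ insertEven k m := by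
  have h2 : ∀ a ∈ m, 2 < a := fun a ha => two_lt_of_companion h ha
  have hmem : ∀ a ∈ m.map (· - 2), a + 2 ∈ m := by
    intro a ha
    obtain ⟨b, hb, rfl⟩ := Multiset.mem_map.1 ha
    have := h2 b hb
    rwa [Nat.sub_add_cancel this.le]
  have hodd : ∀ a ∈ m.map (· - 2), Odd a → 2 * k + 3 ≤ a := by
    intro a ha ho
    have := h.2.1 _ (hmem a ha) (by grind)
    omega
  have hev : ¬ Odd (2 * (Multiset.card m + 1 + k)) :=
    Nat.not_odd_iff_even.2 (even_two_mul _)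
  refine ⟨⟨distinctOddParts_cons.2 ⟨fun a ho => ?_, fun ho => absurd ho hev⟩,
    fun a ha ho => ?_, fun a ha he => ?_⟩, fun hm => ?_⟩
  · have := h.1 (a + 2) (by grind)
    rw [← map_add_map_sub h2] at this
    rwa [Multiset.count_map_eq_count' (· + 2) _ (add_left_injective 2)] at this
  · rcases Multiset.mem_cons.1 ha with rfl | ha
    · exact absurd ho hev
    · have := hodd a ha ho
      omega
  · rw [insertEven, Multiset.card_cons, Multiset.card_map]
    rcases Multiset.mem_cons.1 ha with rfl | ha
    · omega
    · have := h.2.2 _ (hmem a ha) (by grind)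
      omega
  · rcases Multiset.mem_cons.1 hm with h' | h'
    · omega
    · have := hodd _ h' ⟨k, rfl⟩
      omega

lemma exists_insertEven {k : ℕ} {m : Multiset ℕ} (h : companion k m) (ho : 2 * k + 1 ∉ m)
    (he : 2 * (Multiset.card m + k) ∈ m) : ∃ m', companion (k + 2) m' ∧ insertEven k m' = m := by
  obtain ⟨t, ht⟩ := Multiset.exists_cons_of_mem he
  have hcard : Multiset.card m = Multiset.card t + 1 := by rw [ht, Multiset.card_cons]
  have hmem : ∀ a ∈ t, a ∈ m := fun a ha => ht ▸ Multiset.mem_cons_of_mem ha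
  refine ⟨t.map (· + 2), ⟨fun a hodd => ?_, fun a ha hodd => ?_, fun a ha hev => ?_⟩, ?_⟩
  · by_cases ha : a ∈ t.map (· + 2)
    · obtain ⟨b, hb, rfl⟩ := Multiset.mem_map.1 ha
      rw [Multiset.count_map_eq_count' (· + 2) _ (add_left_injective 2)]
      exact (Multiset.count_le_of_le b (ht ▸ Multiset.le_cons_self t _)).trans
        (h.1 b (by grind))
    · rw [Multiset.count_eq_zero.2 ha]
      exact zero_le_one
  · obtain ⟨b, hb, rfl⟩ := Multiset.mem_map.1 ha
    have hbo : Odd b := by grind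
    have := h.2.1 b (hmem b hb) hbo
    have hne : b ≠ 2 * k + 1 := fun h => ho (h ▸ hmem b hb)
    obtain ⟨s, rfl⟩ := hbo
    omega
  · obtain ⟨b, hb, rfl⟩ := Multiset.mem_map.1 ha
    have := h.2.2 b (hmem b hb) (by grind)
    rw [Multiset.card_map]
    omega
  · rw [insertEven, Multiset.card_map, Multiset.map_map]
    have : t.map ((· - 2) ∘ (· + 2)) = t := by
      conv_rhs => rw [← Multiset.map_id' t]
      exact Multiset.map_congr rfl fun a _ => Nat.add_sub_cancel (n := a) (m := 2)
    rw [this, ← hcard, ← ht]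

lemma sum_insertEven {k : ℕ} {m : Multiset ℕ} (h : companion (k + 2) m) :
    (insertEven k m).sum = m.sum + (2 * k + 2) := by
  have h2 : ∀ a ∈ m, 2 < a := fun a ha => two_lt_of_companion h ha
  have := congrArg Multiset.sum (map_add_map_sub h2)
  rw [Multiset.sum_map_add, Multiset.map_id', Multiset.map_const', Multiset.sum_replicate,
    Multiset.card_map, smul_eq_mul] at this
  rw [insertEven, Multiset.sum_cons]
  omega

lemma insertEven_injOn (k : ℕ) : Set.InjOn (insertEven k) {m | 0 ∉ m ∧ companion (k + 2) m} := by
  rintro m ⟨-, hm⟩ m' ⟨-, hm'⟩ h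
  have hc := congrArg Multiset.card h
  simp only [insertEven, Multiset.card_cons, Multiset.card_map] at hc
  rw [insertEven, insertEven, Nat.succ_injective hc, Multiset.cons_inj_right] at h
  rw [← map_add_map_sub fun a ha => two_lt_of_companion hm ha, h,
    map_add_map_sub fun a ha => two_lt_of_companion hm' ha]

lemma sumCount_companion (k n : ℕ) : sumCount (companion k) n = sumCount (companion (k + 1)) n +
    (if 2 * k + 1 ≤ n then sumCount (companion (k + 1)) (n - (2 * k + 1)) else 0) +
    (if 2 * k + 2 ≤ n then sumCount (companion (k + 2)) (n - (2 * k + 2)) else 0) := by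
  have hzero : ∀ {j m}, companion (j + 1) m → 0 ∉ m := fun {j m} h h0 => by
    have := h.2.2 0 h0 Even.zero
    omega
  rw [← ncard_image_sum_eq (f := fun m => (2 * k + 1) ::ₘ m)
      (fun _ _ _ _ h => (Multiset.cons_inj_right _).1 h)
      (fun m _ _ => by rw [Multiset.sum_cons, add_comm]),
    ← ncard_image_sum_eq (insertEven_injOn k) (fun m _ h => sum_insertEven h)]
  have f1 := finite_sum_eq (companion (k + 1)) n
  have hsub : ∀ m, m ∈ (fun m => (2 * k + 1) ::ₘ m) '' {m | 0 ∉ m ∧ companion (k + 1) m} →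
      (0 ∉ m ∧ companion k m) := by
    rintro _ ⟨m, hm, rfl⟩
    refine ⟨fun h => ?_, companion_cons_odd.2 hm.2⟩
    rcases Multiset.mem_cons.1 h with h | h
    · omega
    · exact hm.1 h
  have hsub' : ∀ m, m ∈ insertEven k '' {m | 0 ∉ m ∧ companion (k + 2) m} →
      (0 ∉ m ∧ companion k m) := by
    rintro _ ⟨m, hm, rfl⟩
    have := companion_insertEven hm.2
    refine ⟨fun h => ?_, this.1⟩
    have h3 := this.1.2.2 0 h Even.zero
    rw [insertEven, Multiset.card_cons] at h3
    omega
  have f2 := (finite_sum_eq (companion k) n).subset fun m (hm : m ∈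
    {m | m ∈ (fun m => (2 * k + 1) ::ₘ m) '' {m | 0 ∉ m ∧ companion (k + 1) m} ∧ m.sum = n}) =>
    ⟨hsub m hm.1, hm.2⟩
  have f3 := (finite_sum_eq (companion k) n).subset fun m (hm : m ∈
    {m | m ∈ insertEven k '' {m | 0 ∉ m ∧ companion (k + 2) m} ∧ m.sum = n}) =>
    ⟨hsub' m hm.1, hm.2⟩
  have d1 : ∀ m, companion (k + 1) m → 2 * k + 1 ∉ m := fun m h hm => by
    have := h.2.1 _ hm ⟨k, rfl⟩
    omega
  rw [sumCount, sumCount, ← Set.ncard_union_eq ?_ f1 f2, ← Set.ncard_union_eq ?_ (f1.union f2) f3]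
  · congr 1
    ext m
    constructor
    · rintro ⟨⟨h0, h⟩, hs⟩
      by_cases ho : 2 * k + 1 ∈ m
      · obtain ⟨t, rfl⟩ := Multiset.exists_cons_of_mem ho
        have ht := companion_cons_odd.1 h
        exact Or.inl (Or.inr ⟨⟨t, ⟨hzero ht, ht⟩, rfl⟩, hs⟩)
      by_cases he : 2 * (Multiset.card m + k) ∈ m
      · obtain ⟨t, ht, rfl⟩ := exists_insertEven h ho he
        exact Or.inr ⟨⟨t, ⟨hzero ht, ht⟩, rfl⟩, hs⟩
      · refine Or.inl (Or.inl ⟨⟨h0, h.1, fun a ha hodd => ?_, fun a ha hev => ?_⟩, hs⟩)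
        · have := h.2.1 a ha hodd
          have hne : a ≠ 2 * k + 1 := fun h => ho (h ▸ ha)
          obtain ⟨s, rfl⟩ := hodd
          omega
        · have := h.2.2 a ha hev
          have hne : a ≠ 2 * (Multiset.card m + k) := fun h => he (h ▸ ha)
          obtain ⟨s, rfl⟩ := hev
          omega
    · rintro ((h | h) | h)
      · exact ⟨⟨h.1.1, companion_succ_le h.1.2⟩, h.2⟩
      · exact ⟨hsub m h.1, h.2⟩
      · exact ⟨hsub' m h.1, h.2⟩
  · rw [Set.disjoint_left]
    rintro m (hm | hm) ⟨⟨t, ht, rfl⟩, -⟩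
    · have := hm.1.2.2.2 _ (Multiset.mem_cons_self _ _) (even_two_mul _)
      rw [insertEven, Multiset.card_cons, Multiset.card_map] at this
      omega
    · obtain ⟨⟨s, -, hs⟩, -⟩ := hm
      refine (companion_insertEven ht.2).2 ?_
      rw [← hs]
      exact Multiset.mem_cons_self _ _
  · rw [Set.disjoint_left]
    rintro m hm ⟨⟨t, ht, rfl⟩, -⟩
    exact d1 _ hm.1.2 (Multiset.mem_cons_self _ _)

lemma sumCount_zero {P : Multiset ℕ → Prop} (h : P 0) : sumCount P 0 = 1 := by
  rw [sumCount, Set.ncard_eq_one]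
  refine ⟨0, Set.ext fun m => ⟨fun hm => ?_, ?_⟩⟩
  · by_contra hne
    obtain ⟨a, ha⟩ := Multiset.exists_mem_of_ne_zero hne
    have := Multiset.le_sum_of_mem ha
    rw [hm.2] at this
    exact hm.1.1 (Nat.le_zero.1 this ▸ ha)
  · rintro rfl
    exact ⟨⟨Multiset.notMem_zero 0, h⟩, rfl⟩

lemma sumCount_eq_zero {P : Multiset ℕ → Prop} {n : ℕ} (hn : n ≠ 0)
    (h : ∀ m, P m → ∀ a ∈ m, n < a) : sumCount P n = 0 := by
  rw [sumCount, (Set.ncard_eq_zero (finite_sum_eq P n)), Set.eq_empty_iff_forall_notMem]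
  rintro m ⟨⟨-, hP⟩, hs⟩
  have hne : m ≠ 0 := by
    rintro rfl
    exact hn hs.symm
  obtain ⟨a, ha⟩ := Multiset.exists_mem_of_ne_zero hne
  have h1 := Multiset.le_sum_of_mem ha
  have h2 := h m hP a ha
  omega

lemma sumCount_companion_eq_ite {k n : ℕ} (h : n < k) :
    sumCount (companion k) n = if n = 0 then 1 else 0 := by
  split_ifs with hn
  · subst hn
    exact sumCount_zero ⟨fun a _ => by simp, fun a ha => absurd ha (Multiset.notMem_zero a),
      fun a ha => absurd ha (Multiset.notMem_zero a)⟩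
  · refine sumCount_eq_zero hn fun m hm a ha => ?_
    rcases Nat.even_or_odd a with he | ho
    · have := hm.2.2 a ha he
      omega
    · have := hm.2.1 a ha ho
      omega

lemma sumCount_insert {s : Set ℕ} {a : ℕ} (ha : a ≠ 0) (has : a ∉ s) (n : ℕ) :
    sumCount (fun m => ∀ b ∈ m, b ∈ insert a s) n = sumCount (fun m => ∀ b ∈ m, b ∈ s) n +
      if a ≤ n then sumCount (fun m => ∀ b ∈ m, b ∈ insert a s) (n - a) else 0 := by
  rw [← ncard_image_sum_eq (f := fun m => a ::ₘ m) (fun _ _ _ _ h => (Multiset.cons_inj_right _).1 h)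
      (fun m _ _ => by rw [Multiset.sum_cons, add_comm])]
  have hcons : ∀ m, m ∈ (fun m => a ::ₘ m) '' {m | 0 ∉ m ∧ ∀ b ∈ m, b ∈ insert a s} →
      0 ∉ m ∧ ∀ b ∈ m, b ∈ insert a s := by
    rintro _ ⟨m, hm, rfl⟩
    refine ⟨fun h => ?_, fun b hb => ?_⟩
    · rcases Multiset.mem_cons.1 h with h | h
      · exact ha h.symm
      · exact hm.1 h
    · rcases Multiset.mem_cons.1 hb with rfl | hb
      · exact Set.mem_insert _ _
      · exact hm.2 b hb
  rw [sumCount, sumCount, ← Set.ncard_union_eq ?_ (finite_sum_eq _ n)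
    ((finite_sum_eq (fun m => ∀ b ∈ m, b ∈ insert a s) n).subset
      fun m hm => ⟨hcons m hm.1, hm.2⟩)]
  · congr 1
    ext m
    constructor
    · rintro ⟨⟨h0, h⟩, hs⟩
      by_cases hm : a ∈ m
      · obtain ⟨t, rfl⟩ := Multiset.exists_cons_of_mem hm
        exact Or.inr ⟨⟨t, ⟨fun h => h0 (Multiset.mem_cons_of_mem h),
          fun b hb => h b (Multiset.mem_cons_of_mem hb)⟩, rfl⟩, hs⟩
      · exact Or.inl ⟨⟨h0, fun b hb => (h b hb).resolve_left fun hba => hm (hba ▸ hb)⟩, hs⟩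
    · rintro (h | h)
      · exact ⟨⟨h.1.1, fun b hb => Or.inr (h.1.2 b hb)⟩, h.2⟩
      · exact ⟨hcons m h.1, h.2⟩
  · rw [Set.disjoint_left]
    rintro m hm ⟨⟨t, ht, rfl⟩, -⟩
    exact has (hm.1.2 a (Multiset.mem_cons_self _ _))

end Counting

section GeneratingFunctions

open PowerSeries

/-- The generating function of `sumCount P`. -/
noncomputable def sumSeries (P : Multiset ℕ → Prop) : ℤ⟦X⟧ := mk fun n => (sumCount P n : ℤ)

lemma sumSeries_companion (k : ℕ) : sumSeries (companion k) =
    (1 + X ^ (2 * k + 1)) * sumSeries (companion (k + 1)) +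
      X ^ (2 * k + 2) * sumSeries (companion (k + 2)) := by
  ext n
  simp only [sumSeries, add_mul, one_mul, map_add, coeff_X_pow_mul', coeff_mk,
    sumCount_companion k n]
  push_cast
  rfl

lemma sumSeries_insert {s : Set ℕ} {a : ℕ} (ha : a ≠ 0) (has : a ∉ s) :
    sumSeries (fun m => ∀ b ∈ m, b ∈ insert a s) * (1 - X ^ a) =
      sumSeries (fun m => ∀ b ∈ m, b ∈ s) := by
  have : sumSeries (fun m => ∀ b ∈ m, b ∈ insert a s) = sumSeries (fun m => ∀ b ∈ m, b ∈ s) +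
      X ^ a * sumSeries (fun m => ∀ b ∈ m, b ∈ insert a s) := by
    ext n
    simp only [sumSeries, map_add, coeff_X_pow_mul', coeff_mk]
    rw [sumCount_insert ha has n]
    push_cast
    rfl
  linear_combination this

/-- The positive integers below `8 L` congruent to `3`, `4` or `5` modulo `8`. -/
def residueSet (L : ℕ) : Set ℕ := {a | a < 8 * L ∧ (a % 8 = 3 ∨ a % 8 = 4 ∨ a % 8 = 5)}

lemma sumSeries_residueSet (L : ℕ) : sumSeries (fun m => ∀ b ∈ m, b ∈ residueSet L) *
    (qPoch (X ^ 3) (X ^ 8) L * qPoch (X ^ 4) (X ^ 8) L * qPoch (X ^ 5) (X ^ 8) L) = 1 := by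
  induction L with
  | zero =>
    simp only [qPoch_zero, mul_one]
    ext n
    rw [sumSeries, coeff_mk, coeff_one]
    split_ifs with hn
    · subst hn
      rw [sumCount_zero fun b hb => absurd hb (Multiset.notMem_zero b), Nat.cast_one]
    · rw [sumCount_eq_zero hn fun m hm a ha => absurd (hm a ha).1 (by omega), Nat.cast_zero]
  | succ L ih =>
    have hset : residueSet (L + 1) =
        insert (8 * L + 5) (insert (8 * L + 4) (insert (8 * L + 3) (residueSet L))) := by
      ext a
      simp only [residueSet, Set.mem_ofPred_eq, Set.mem_insert_iff]
      omega
    have h3 := sumSeries_insert (s := residueSet L) (a := 8 * L + 3) (by omega)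
      (by simp only [residueSet, Set.mem_ofPred_eq]; omega)
    have h4 := sumSeries_insert (s := insert (8 * L + 3) (residueSet L)) (a := 8 * L + 4)
      (by omega) (by simp only [residueSet, Set.mem_ofPred_eq, Set.mem_insert_iff]; omega)
    have h5 := sumSeries_insert (s := insert (8 * L + 4) (insert (8 * L + 3) (residueSet L)))
      (a := 8 * L + 5)
      (by omega) (by simp only [residueSet, Set.mem_ofPred_eq, Set.mem_insert_iff]; omega)
    rw [← hset] at h5
    rw [← h3, ← h4, ← h5] at ih
    simp only [qPoch_succ]
    linear_combination ih

lemma coeff_eq_of_mk_eq {N n : ℕ} (hn : n < N) {f g : ℤ⟦X⟧}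
    (h : Ideal.Quotient.mk (Ideal.span {(X : ℤ⟦X⟧) ^ N}) f = Ideal.Quotient.mk _ g) :
    coeff n f = coeff n g := by
  rw [Ideal.Quotient.eq, Ideal.mem_span_singleton, X_pow_dvd_iff] at h
  simpa [sub_eq_zero] using h n hn

lemma sumCount_companion_eq_residueSet {N n : ℕ} (hn : n < N) :
    sumCount (companion 1) n = sumCount (fun m => ∀ b ∈ m, b ∈ residueSet N) n := by
  set φ := Ideal.Quotient.mk (Ideal.span {(X : ℤ⟦X⟧) ^ N}) with hφ
  have hx : φ X ^ N = 0 := by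
    rw [← map_pow, hφ, Ideal.Quotient.eq_zero_iff_mem]
    exact Ideal.mem_span_singleton_self _
  have h1 := mul_prod_eq_one_of_recurrence hx (C := fun k => φ (sumSeries (companion (k + 1))))
    (fun k => by
      rw [sumSeries_companion (k + 1)]
      simp only [map_add, map_mul, map_pow, map_one]
      ring)
    (fun k hk => by
      rw [← map_one φ, hφ, Ideal.Quotient.eq, Ideal.mem_span_singleton, X_pow_dvd_iff]
      intro m hm
      rw [map_sub, sumSeries, coeff_mk, sumCount_companion_eq_ite (by omega), coeff_one]
      split_ifs <;> simp)
  have h2 := congrArg φ (sumSeries_residueSet N)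
  simp only [map_mul, map_qPoch, map_pow, map_one] at h2
  have h3 : φ (sumSeries (companion 1)) =
      φ (sumSeries (fun m => ∀ b ∈ m, b ∈ residueSet N)) := by
    simp only [zero_add] at h1
    exact (IsUnit.of_mul_eq_one_right _ h2).mul_right_cancel (h1.trans h2.symm)
  have h4 := coeff_eq_of_mk_eq hn h3
  simp only [sumSeries, coeff_mk] at h4
  exact_mod_cast h4

end GeneratingFunctions

theorem new_companion_second (n : ℕ) :
    {p : n.Partition | distinctOddParts p.parts ∧ minOddGe p.parts 3 ∧
        minEvenGe p.parts (2 * (Multiset.card p.parts + 1))}.ncard =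
      {p : n.Partition | ∀ a ∈ p.parts, a % 8 = 3 ∨ a % 8 = 4 ∨ a % 8 = 5}.ncard := by
  have h1 := ncard_partition_eq_sumCount (companion 1) n
  have h2 := ncard_partition_eq_sumCount (fun m => ∀ b ∈ m, b ∈ residueSet (n + 1)) n
  rw [sumCount_companion_eq_residueSet (Nat.lt_succ_self n), ← h2] at h1
  refine h1.trans (congrArg Set.ncard (Set.ext fun p => forall₂_congr fun a ha => ?_))
  have := p.le_of_mem_parts ha
  simp only [residueSet, Set.mem_ofPred_eq]
  omega
end
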